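/- arXiv:2011.05724 — 3 statements merged into one kernel-verified Lean document; each statement's English description precedes it below -/
import Mathlib

section
/- Let V ⊆ V' be an extension of valuation rings such that V' is ind-smooth over V. Then for every prime ideal q of V, the extension ideal qV' is a prime ideal of V' (equivalently, V'/qV' is an integral domain). -/
universe u v

/-- A ring homomorphism `f : A →+* B` is *ind-smooth* if `B` is a filtered colimit of smooth
`A`-algebras; equivalently (and this is the definition used here), every `A`-algebra homomorphism
`E → B` from a finitely presented `A`-algebra `E` factors through a smooth (i.e. finitely
presented and formally smooth) `A`-algebra. -/
def RingHom.IsIndSmooth {A : Type u} {B : Type v} [CommRing A] [CommRing B]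
    (f : A →+* B) : Prop :=
  ∀ (E : Type u) [CommRing E] [Algebra A E], Algebra.FinitePresentation A E →
    ∀ w : E →+* B, w.comp (algebraMap A E) = f →
      ∃ (S : Type u) (_ : CommRing S) (_ : Algebra A S), Algebra.Smooth A S ∧
        ∃ (g : E →ₐ[A] S) (h : S →+* B),
          h.comp g.toRingHom = w ∧ h.comp (algebraMap A S) = f

/-- The value group extension of an extension `f : V → V'` of valuation rings is *trivial* if
every nonzero element `x/y` of the fraction field of `V'` is, up to a unit of `V'`, of the form
`a/b` with `a, b` nonzero in `V`. -/
def RingHom.HasTrivialValueGroupExt {V : Type u} {V' : Type v} [CommRing V] [CommRing V']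
    (f : V →+* V') : Prop :=
  ∀ x y : V', x ≠ 0 → y ≠ 0 → ∃ a b : V, a ≠ 0 ∧ b ≠ 0 ∧ Associated (x * f b) (y * f a)

open scoped TensorProduct

theorem isReduced_of_etale_of_isDomain (R S : Type*) [CommRing R] [IsDomain R] [CommRing S]
    [Algebra R S] [Algebra.Etale R S] : IsReduced S := by
  have : IsReduced (FractionRing R ⊗[R] S) :=
    Algebra.FormallyUnramified.isReduced_of_field (FractionRing R) _
  exact isReduced_of_injective
    (Algebra.TensorProduct.includeRight : S →ₐ[R] FractionRing R ⊗[R] S)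
    (Algebra.TensorProduct.includeRight_injective (IsFractionRing.injective R _))

theorem isReduced_of_smooth_of_isDomain (R S : Type*) [CommRing R] [IsDomain R] [CommRing S]
    [Algebra R S] [Algebra.Smooth R S] : IsReduced S := by
  refine ⟨fun x hx ↦ ?_⟩
  suffices (Submodule.span S {x}).annihilator = ⊤ by
    simpa [Submodule.mem_annihilator_span_singleton] using (Ideal.eq_top_iff_one _).mp this
  by_contra hne
  obtain ⟨m, hm, hle⟩ := Ideal.exists_le_maximal _ hne
  obtain ⟨f, hfm, n, _, _, _⟩ :=
    Algebra.IsSmoothAt.exists_isStandardEtale_mvPolynomial (R := R) (p := m)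
  have := isReduced_of_etale_of_isDomain (MvPolynomial (Fin n) R) (Localization.Away f)
  have h0 : algebraMap S (Localization.Away f) x = 0 := (hx.map _).eq_zero
  obtain ⟨⟨_, k, rfl⟩, hc⟩ :=
    (IsLocalization.map_eq_zero_iff (Submonoid.powers f) (Localization.Away f) x).mp h0
  exact hfm (hm.isPrime.mem_of_pow_mem k
    (hle ((Submodule.mem_annihilator_span_singleton x _).mpr hc)))

theorem Ideal.exists_dvd_of_mem_map {V W : Type*} [CommRing V] [IsDomain V] [ValuationRing V]
    [CommRing W] (f : V →+* W) {q : Ideal V} {x : W} (hx : x ∈ q.map f) :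
    ∃ a ∈ q, f a ∣ x := by
  induction hx using Submodule.span_induction with
  | mem x hx =>
    obtain ⟨a, ha, rfl⟩ := hx
    exact ⟨a, ha, dvd_rfl⟩
  | zero => exact ⟨0, q.zero_mem, dvd_zero _⟩
  | add x y _ _ hx hy =>
    obtain ⟨a, ha, hax⟩ := hx
    obtain ⟨b, hb, hby⟩ := hy
    rcases ValuationRing.dvd_total a b with h | h
    · exact ⟨a, ha, dvd_add hax ((map_dvd f h).trans hby)⟩
    · exact ⟨b, hb, dvd_add ((map_dvd f h).trans hax) hby⟩
  | smul c x _ hx =>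
    obtain ⟨a, ha, hax⟩ := hx
    exact ⟨a, ha, hax.mul_left c⟩

theorem Ideal.isPrime_of_sq_mem {W : Type*} [CommRing W] [IsDomain W] [ValuationRing W]
    {I : Ideal W} (hne : I ≠ ⊤) (h : ∀ x, x ^ 2 ∈ I → x ∈ I) : I.IsPrime := by
  refine ⟨hne, fun {x y} hxy ↦ ?_⟩
  rcases ValuationRing.dvd_total x y with ⟨z, rfl⟩ | ⟨z, rfl⟩
  · exact .inr (h _ (by convert I.mul_mem_right z hxy using 1; ring))
  · exact .inl (h _ (by convert I.mul_mem_right z hxy using 1; ring))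

theorem RingHom.mem_map_of_sq_mem_map_of_smooth {A S B : Type*} [CommRing A] [CommRing S]
    [CommRing B] [Algebra A S] [Algebra.Smooth A S] (h : S →+* B) {q : Ideal A} [q.IsPrime] {s : S}
    (hs : s ^ 2 ∈ q.map (algebraMap A S)) : h s ∈ q.map (h.comp (algebraMap A S)) := by
  let T := (A ⧸ q) ⊗[A] S
  have : IsReduced T := isReduced_of_smooth_of_isDomain (A ⧸ q) T
  have hq : ∀ z ∈ q.map (algebraMap A S),
      (Algebra.TensorProduct.includeRight : S →ₐ[A] T) z = 0 := by
    change q.map (algebraMap A S) ≤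
      RingHom.ker (Algebra.TensorProduct.includeRight : S →ₐ[A] T)
    rw [Ideal.map_le_iff_le_comap]
    intro a ha
    rw [Ideal.mem_comap, RingHom.mem_ker, AlgHom.commutes,
      IsScalarTower.algebraMap_apply A (A ⧸ q) T, Ideal.Quotient.algebraMap_eq,
      Ideal.Quotient.eq_zero_iff_mem.mpr ha, map_zero]
  have h0 : (Algebra.TensorProduct.includeRight : S →ₐ[A] T) s = 0 :=
    (pow_eq_zero_iff two_ne_zero).mp (by rw [← map_pow]; exact hq _ hs)
  let I := q.map (h.comp (algebraMap A S))
  let := ((Ideal.Quotient.mk I).comp (h.comp (algebraMap A S))).toAlgebra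
  let φ : (A ⧸ q) →ₐ[A] B ⧸ I := Ideal.Quotient.liftₐ q (Algebra.ofId A _) fun a ha ↦
    Ideal.Quotient.eq_zero_iff_mem.mpr (Ideal.mem_map_of_mem _ ha)
  let ψ : S →ₐ[A] B ⧸ I := ⟨(Ideal.Quotient.mk I).comp h, fun _ ↦ rfl⟩
  have := congrArg (Algebra.TensorProduct.productMap φ ψ) h0
  rw [Algebra.TensorProduct.includeRight_apply, Algebra.TensorProduct.productMap_right_apply,
    map_zero] at this
  exact Ideal.Quotient.eq_zero_iff_mem.mp this

open MvPolynomial in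
theorem RingHom.IsIndSmooth.mem_map_of_sq_eq {A : Type u} {B : Type v} [CommRing A] [CommRing B]
    {f : A →+* B} (hf : f.IsIndSmooth) {q : Ideal A} [q.IsPrime] {a : A} (ha : a ∈ q) {x y : B}
    (hxy : x ^ 2 = f a * y) : x ∈ q.map f := by
  let r : MvPolynomial (Fin 2) A := X 0 ^ 2 - C a * X 1
  have hw : ∀ p ∈ Ideal.span {r}, eval₂Hom f ![x, y] p = 0 := by
    change Ideal.span {r} ≤ RingHom.ker (eval₂Hom f ![x, y])
    simp [Ideal.span_le, r, RingHom.mem_ker, hxy]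
  obtain ⟨S, _, _, _, g, h, hgw, hS⟩ := hf (MvPolynomial (Fin 2) A ⧸ Ideal.span {r})
    (.quotient (Submodule.fg_span (Set.finite_singleton r)))
    (Ideal.Quotient.lift _ (eval₂Hom f ![x, y]) hw)
    (by ext b; exact eval₂Hom_C f _ b)
  let k : MvPolynomial (Fin 2) A →ₐ[A] S := g.comp (Ideal.Quotient.mkₐ A (Ideal.span {r}))
  have hr : k r = 0 := by
    simp [k, Ideal.Quotient.eq_zero_iff_mem.mpr (Ideal.mem_span_singleton_self r)]
  have hk : k (X 0) ^ 2 = algebraMap A S a * k (X 1) := by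
    have hC : k (C a) = algebraMap A S a := k.commutes a
    rw [← hC, ← map_pow, ← map_mul, ← sub_eq_zero, ← map_sub]
    exact hr
  have hx : h (k (X 0)) = x := by
    have := RingHom.congr_fun hgw (Ideal.Quotient.mk _ (X 0))
    simpa [k] using this
  rw [← hx, ← hS]
  exact RingHom.mem_map_of_sq_mem_map_of_smooth h
    (hk ▸ Ideal.mul_mem_right _ _ (Ideal.mem_map_of_mem _ ha))

/-- If `V ⊆ V'` is an extension of valuation rings with `V'` ind-smooth over
`V`, then for every prime ideal `q` of `V` the extension `qV'` is a prime ideal of `V'`. -/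
theorem isIndSmooth_extension_map_prime
    (V : Type u) (V' : Type v) [CommRing V] [IsDomain V] [ValuationRing V]
    [CommRing V'] [IsDomain V'] [ValuationRing V'] [Algebra V V']
    (hinj : Function.Injective (algebraMap V V'))
    [IsLocalHom (algebraMap V V')]
    (hsm : (algebraMap V V').IsIndSmooth) :
    ∀ q : Ideal V, q.IsPrime → (q.map (algebraMap V V')).IsPrime := by
  intro q hq
  refine Ideal.isPrime_of_sq_mem (fun htop ↦ ?_) fun x hx ↦ ?_
  · obtain ⟨a, ha, hdvd⟩ := Ideal.exists_dvd_of_mem_map (algebraMap V V')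
      ((Ideal.eq_top_iff_one _).mp htop)
    exact hq.ne_top (q.eq_top_of_isUnit_mem ha
      (isUnit_of_map_unit (algebraMap V V') a (isUnit_of_dvd_one hdvd)))
  · obtain ⟨a, ha, y, hy⟩ := Ideal.exists_dvd_of_mem_map _ hx
    exact hsm.mem_map_of_sq_eq ha hy
end

section
/- Let V ⊆ V' be an extension of valuation rings such that V' is ind-smooth over V. Then for any prime ideals q1 ⊆ q2 of V such that there is no prime ideal of V strictly between q1 and q2, the induced extension of valuation rings V_{q2}/q1·V_{q2} ⊆ V'_{q2V'}/q1·V'_{q2V'} is ind-smooth. -/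
universe u v

/-- The induced ring homomorphism `V_{q2}/q1·V_{q2} →+* V'_{q2V'}/q1·V'_{q2V'}` attached to an
algebra map `V → V'` and prime ideals `q1 ⊆ q2` of `V` such that `q2·V'` is prime and contracts
to `q2`. -/
noncomputable def inducedQuotLocMap
    (V : Type u) (V' : Type v) [CommRing V] [CommRing V'] [Algebra V V']
    (q1 q2 : Ideal V) [q2.IsPrime] [(q2.map (algebraMap V V')).IsPrime]
    (hc : q2 = (q2.map (algebraMap V V')).comap (algebraMap V V')) :
    Localization.AtPrime q2 ⧸ (q1.map (algebraMap V (Localization.AtPrime q2))) →+*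
      Localization.AtPrime (q2.map (algebraMap V V')) ⧸
        (q1.map ((algebraMap V' (Localization.AtPrime (q2.map (algebraMap V V')))).comp
          (algebraMap V V'))) :=
  Ideal.quotientMap
    (q1.map ((algebraMap V' (Localization.AtPrime (q2.map (algebraMap V V')))).comp
      (algebraMap V V')))
    (Localization.localRingHom q2 (q2.map (algebraMap V V')) (algebraMap V V') hc)
    (by
      rw [Ideal.map_le_iff_le_comap]
      intro x hx
      rw [Ideal.mem_comap, Ideal.mem_comap, Localization.localRingHom_to_map]
      exact Ideal.mem_map_of_mem _ hx)

open MvPolynomial in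
/-- Equational criterion for ind-smoothness: every finite system of polynomial equations over `A`
together with a solution in `B` can be solved in a smooth `A`-algebra mapping to `B`. -/
theorem RingHom.isIndSmooth_algebraMap_iff {A : Type u} {B : Type v} [CommRing A] [CommRing B]
    [Algebra A B] :
    (algebraMap A B).IsIndSmooth ↔
      ∀ (σ ι : Type) [_root_.Finite σ] [_root_.Finite ι] (f : ι → MvPolynomial σ A) (b : σ → B),
        (∀ i, aeval b (f i) = 0) →
        ∃ (S : Type u) (_ : CommRing S) (_ : Algebra A S), Algebra.Smooth A S ∧
          ∃ (y : σ → S) (h : S →ₐ[A] B), (∀ j, h (y j) = b j) ∧ ∀ i, aeval y (f i) = 0 := by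
  constructor
  · intro H σ ι _ _ f b hb
    have hI : (Ideal.span (Set.range f)).FG := Submodule.fg_span (Set.finite_range f)
    have hker : ∀ p ∈ Ideal.span (Set.range f), aeval b p = 0 := by
      intro p hp
      have hle : Ideal.span (Set.range f) ≤ RingHom.ker (aeval b : MvPolynomial σ A →ₐ[A] B) := by
        rw [Ideal.span_le]
        rintro _ ⟨i, rfl⟩
        exact hb i
      exact hle hp
    obtain ⟨S, _, _, hS, g, h, hw, hA⟩ := H (MvPolynomial σ A ⧸ Ideal.span (Set.range f))
      (Algebra.FinitePresentation.quotient hI)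
      (Ideal.Quotient.liftₐ _ (aeval b) hker).toRingHom (AlgHom.comp_algebraMap _)
    refine ⟨S, _, _, hS, fun j => g (Ideal.Quotient.mk _ (X j)),
      { h with commutes' := fun a => RingHom.congr_fun hA a }, fun j => ?_, fun i => ?_⟩
    · have := RingHom.congr_fun hw (Ideal.Quotient.mk _ (X j))
      refine this.trans ?_
      change aeval b (X j) = b j
      simp
    · have hcomp : (aeval fun j => g (Ideal.Quotient.mk _ (X j)) : MvPolynomial σ A →ₐ[A] S)
          = g.comp (Ideal.Quotient.mkₐ A (Ideal.span (Set.range f))) := by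
        ext j
        simp
      rw [hcomp, AlgHom.comp_apply, Ideal.Quotient.mkₐ_eq_mk,
        Ideal.Quotient.eq_zero_iff_mem.mpr (Ideal.subset_span (Set.mem_range_self i)), map_zero]
  · intro H E _ _ hE w hw
    obtain ⟨n, φ, hφ, hfg⟩ := hE.out
    obtain ⟨m, f, hf⟩ := Submodule.fg_iff_exists_fin_generating_family.mp hfg
    let w' : E →ₐ[A] B := { w with commutes' := fun a => RingHom.congr_fun hw a }
    have hb : ∀ p, aeval (fun j => w (φ (X j))) p = w (φ p) := by
      have : (aeval fun j => w (φ (X j)) : MvPolynomial (Fin n) A →ₐ[A] B) = w'.comp φ := by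
        ext j
        simp [w']
      exact AlgHom.congr_fun this
    have hfker (i) : φ (f i) = 0 := by
      have : f i ∈ RingHom.ker φ.toRingHom := by
        rw [← hf]
        exact Submodule.subset_span ⟨i, rfl⟩
      exact this
    obtain ⟨S, _, _, hS, y, h, hy, hy0⟩ := H (Fin n) (Fin m) f (fun j => w (φ (X j)))
      (fun i => by rw [hb, hfker, map_zero])
    have hle : RingHom.ker φ.toRingHom ≤
        RingHom.ker (aeval y : MvPolynomial (Fin n) A →ₐ[A] S).toRingHom := by
      rw [← hf]
      refine Submodule.span_le.mpr ?_
      rintro _ ⟨i, rfl⟩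
      exact hy0 i
    refine ⟨S, _, _, hS, AlgHom.liftOfSurjective φ hφ (aeval y) hle, h.toRingHom, ?_,
      AlgHom.comp_algebraMap h⟩
    ext e
    obtain ⟨p, rfl⟩ := hφ e
    have hcomp : h.comp (aeval y) = aeval fun j => w (φ (X j)) := by
      ext j
      simp [hy]
    change h (AlgHom.liftOfSurjective φ hφ (aeval y) hle (φ p)) = _
    rw [AlgHom.liftOfSurjective_apply, ← hb, ← hcomp]
    rfl

open MvPolynomial in
/-- Clearing denominators: for some `n`, the polynomial `s ^ n * f(x)` is a polynomial in `s` and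
the products `s * x j`. -/
theorem MvPolynomial.exists_aeval_eq_X_none_pow_mul_rename {σ : Type*} {R : Type*} [CommRing R]
    (f : MvPolynomial σ R) :
    ∃ (n : ℕ) (a : MvPolynomial (Option σ) R),
      aeval (fun o : Option σ => o.elim (X none : MvPolynomial (Option σ) R)
        (fun j => X none * X (some j))) a = X none ^ n * rename some f := by
  induction f using MvPolynomial.induction_on with
  | C r => exact ⟨0, C r, by simp [algebraMap_eq]⟩
  | add p q hp hq =>
    obtain ⟨n, a, ha⟩ := hp
    obtain ⟨m, b, hb⟩ := hq
    refine ⟨n + m, X none ^ m * a + X none ^ n * b, ?_⟩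
    simp only [map_add, map_mul, map_pow, aeval_X, Option.elim_none, ha, hb]
    ring
  | mul_X p j hp =>
    obtain ⟨n, a, ha⟩ := hp
    refine ⟨n + 1, a * X (some j), ?_⟩
    simp only [map_mul, aeval_X, Option.elim_some, ha, rename_X]
    ring

open MvPolynomial in
/-- If `f` and `a` are related as in `MvPolynomial.exists_aeval_eq_X_none_pow_mul_rename`, then
`a` evaluated at `s` and `s * x j` is `s ^ n * f(x)` in every algebra. -/
theorem MvPolynomial.aeval_elim_eq_pow_mul_aeval {σ R C : Type*} [CommRing R] [CommRing C]
    [Algebra R C] {f : MvPolynomial σ R} {n : ℕ} {a : MvPolynomial (Option σ) R}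
    (ha : aeval (fun o : Option σ => o.elim (X none : MvPolynomial (Option σ) R)
        (fun j => X none * X (some j))) a = X none ^ n * rename some f)
    (z : Option σ → C) (x : σ → C) (hx : ∀ j, z none * x j = z (some j)) :
    aeval z a = z none ^ n * aeval x f := by
  have := congrArg (aeval (fun o : Option σ => o.elim (z none) x)) ha
  rw [map_mul, map_pow, aeval_X, Option.elim_none, aeval_rename] at this
  refine Eq.trans ?_ this
  rw [← AlgHom.comp_apply]
  congr 1
  ext o
  cases o <;> simp [hx]

open MvPolynomial in
/-- Ind-smoothness of `A → B` passes to localizations of `B` at non-zero-divisors. -/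
theorem RingHom.IsIndSmooth.of_isLocalization {A : Type u} {B C : Type v} [CommRing A]
    [CommRing B] [CommRing C] [Algebra A B] [Algebra B C] [Algebra A C] [IsScalarTower A B C]
    (M : Submonoid B) (hM : M ≤ nonZeroDivisors B) [IsLocalization M C]
    (H : (algebraMap A B).IsIndSmooth) : (algebraMap A C).IsIndSmooth := by
  rw [RingHom.isIndSmooth_algebraMap_iff] at H ⊢
  intro σ ι _ _ f c hc
  obtain ⟨s, hs⟩ := IsLocalization.exist_integer_multiples_of_finite M c
  choose y hy using hs
  choose n a ha using fun i => (f i).exists_aeval_eq_X_none_pow_mul_rename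
  have hinj : Function.Injective (algebraMap B C) := IsLocalization.injective C hM
  have hz (i) : aeval (fun o : Option σ => o.elim (s : B) y) (a i) = 0 := by
    apply hinj
    rw [map_zero, ← aeval_algebraMap_apply,
      aeval_elim_eq_pow_mul_aeval (ha i) _ c, hc, mul_zero]
    intro j
    simp [hy, Algebra.smul_def]
  obtain ⟨S, _, _, hS, z, h, hzh, hz0⟩ := H (Option σ) ι a _ hz
  let L := Localization.Away (z none)
  have hu : IsUnit (((IsScalarTower.toAlgHom A B C).comp h) (z none)) := by
    simpa [hzh] using IsLocalization.map_units C s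
  have : Algebra.Smooth S L := Algebra.Smooth.of_isLocalization_Away (z none)
  have hL : IsUnit (algebraMap S L (z none)) := IsLocalization.Away.algebraMap_isUnit _
  obtain ⟨u, hu'⟩ := hL
  let k : L →ₐ[A] C := IsLocalization.Away.liftAlgHom (z none) hu
  have hk (t : S) : k (algebraMap S L t) = algebraMap B C (h t) :=
    IsLocalization.Away.lift_eq (S := L) (z none) hu t
  have hx (j : σ) : algebraMap S L (z none) * (↑u⁻¹ * algebraMap S L (z (some j))) =
      algebraMap S L (z (some j)) := by
    rw [← hu', Units.mul_inv_cancel_left]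
  refine ⟨L, _, _, Algebra.Smooth.comp A S L, fun j => ↑u⁻¹ * algebraMap S L (z (some j)), k,
    fun j => ?_, fun i => ?_⟩
  · apply (IsLocalization.map_units C s).mul_left_cancel
    have := congrArg k (hx j)
    rw [map_mul, hk, hk, hzh, hzh] at this
    refine this.trans ?_
    simp [hy, Algebra.smul_def]
  · have := aeval_elim_eq_pow_mul_aeval (ha i) (algebraMap S L ∘ z) _ hx
    rw [aeval_algebraMap_apply, hz0, map_zero, Function.comp_apply, ← hu', ← Units.val_pow_eq_pow_val] at this
    exact (Units.mul_right_eq_zero _).mp this.symm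

open MvPolynomial in
/-- If every element of `B` is an element of `A` up to a unit coming from `A`, the same holds for
polynomials. -/
theorem MvPolynomial.exists_map_eq_C_mul {σ A B : Type*} [CommRing A] [CommRing B] [Algebra A B]
    (H : ∀ b : B, ∃ u a : A, IsUnit (algebraMap A B u) ∧ algebraMap A B a = algebraMap A B u * b)
    (f : MvPolynomial σ B) :
    ∃ (u : A) (F : MvPolynomial σ A), IsUnit (algebraMap A B u) ∧
      map (algebraMap A B) F = C (algebraMap A B u) * f := by
  induction f using MvPolynomial.induction_on with
  | C r =>
    obtain ⟨u, a, hu, ha⟩ := H r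
    exact ⟨u, C a, hu, by simp [ha]⟩
  | add p q hp hq =>
    obtain ⟨u, a, hu, ha⟩ := hp
    obtain ⟨t, b, ht, hb⟩ := hq
    refine ⟨u * t, C t * a + C u * b, by simpa using ⟨hu, ht⟩, ?_⟩
    simp only [map_add, map_mul, map_C, ha, hb]
    ring
  | mul_X p j hp =>
    obtain ⟨u, a, hu, ha⟩ := hp
    exact ⟨u, a * X j, hu, by simp only [map_mul, map_X, ha, mul_assoc]⟩

open MvPolynomial TensorProduct in
/-- Ind-smoothness of `A → B` passes to `A' → B'`, where `A'` is a localization of a quotient of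
`A`, and `B'` is the quotient of `B` by elements which are multiples of elements of `A` vanishing
in `A'`. -/
theorem RingHom.IsIndSmooth.of_surjective {A A' : Type u} {B B' : Type v} [CommRing A]
    [CommRing A'] [CommRing B] [CommRing B'] [Algebra A A'] [Algebra A B] [Algebra A B']
    [Algebra A' B'] [IsScalarTower A A' B'] (π : B →ₐ[A] B') (hπ : Function.Surjective π)
    (hker : ∀ b, π b = 0 → ∃ c t, algebraMap A A' c = 0 ∧ b = algebraMap A B c * t)
    (hA' : ∀ x : A', ∃ u a : A,
      IsUnit (algebraMap A A' u) ∧ algebraMap A A' a = algebraMap A A' u * x)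
    (H : (algebraMap A B).IsIndSmooth) : (algebraMap A' B').IsIndSmooth := by
  rw [RingHom.isIndSmooth_algebraMap_iff] at H ⊢
  intro σ ι _ _ f x hx
  choose u F hu hF using fun i => exists_map_eq_C_mul hA' (f i)
  choose b hb using fun j => hπ (x j)
  have h0 (i) : π (aeval b (F i)) = 0 := by
    have hcomp : (π.comp (aeval b)) (F i) = aeval x (map (algebraMap A A') (F i)) := by
      rw [aeval_map_algebraMap]
      congr 1
      ext j
      simp [hb]
    rw [← AlgHom.comp_apply, hcomp, hF, map_mul, hx, mul_zero]
  choose c t hc ht using fun i => hker _ (h0 i)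
  obtain ⟨S, _, _, hS, y, h, hy, hy0⟩ := H (σ ⊕ ι) ι
    (fun i => rename Sum.inl (F i) - C (c i) * X (Sum.inr i)) (Sum.elim b t) (fun i => by
      rw [map_sub, aeval_rename, map_mul, aeval_X, aeval_C, Sum.elim_inr, Sum.elim_comp_inl, ht,
        sub_self])
  refine ⟨A' ⊗[A] S, _, _, inferInstance, fun j => 1 ⊗ₜ y (Sum.inl j),
    Algebra.TensorProduct.lift (Algebra.ofId A' B') (π.comp h) (fun _ _ => Commute.all _ _),
    fun j => by simp [hy, hb], fun i => ?_⟩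
  have hyi : aeval (fun j => y (Sum.inl j)) (F i) = algebraMap A S (c i) * y (Sum.inr i) := by
    have := hy0 i
    rw [map_sub, aeval_rename, map_mul, aeval_X, aeval_C] at this
    exact sub_eq_zero.mp this
  have hcomp : aeval (fun j => (1 : A') ⊗ₜ[A] y (Sum.inl j)) (map (algebraMap A A') (F i)) =
      (Algebra.TensorProduct.includeRight : S →ₐ[A] A' ⊗[A] S)
        (aeval (fun j => y (Sum.inl j)) (F i)) := by
    rw [aeval_map_algebraMap, ← AlgHom.comp_apply]
    congr 1
    ext j
    simp
  rw [hyi, map_mul, AlgHom.commutes, IsScalarTower.algebraMap_apply A A', hc, map_zero, zero_mul,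
    hF, map_mul, aeval_C] at hcomp
  exact ((hu i).map (algebraMap A' (A' ⊗[A] S))).mul_right_eq_zero.mp hcomp

/-- In an algebra over a valuation ring, the elements of an extended ideal are multiples of single
elements of the ideal. -/
theorem ValuationRing.exists_eq_mul_of_mem_map {V B : Type*} [CommRing V] [IsDomain V]
    [ValuationRing V] [CommRing B] (f : V →+* B) (I : Ideal V) {b : B} (hb : b ∈ I.map f) :
    ∃ c ∈ I, ∃ t, b = f c * t := by
  induction hb using Submodule.span_induction with
  | mem x hx =>
    obtain ⟨c, hc, rfl⟩ := hx
    exact ⟨c, hc, 1, (mul_one _).symm⟩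
  | zero => exact ⟨0, I.zero_mem, 0, by simp⟩
  | smul a x _ hx =>
    obtain ⟨c, hc, t, rfl⟩ := hx
    exact ⟨c, hc, a * t, by rw [smul_eq_mul]; ring⟩
  | add x y _ _ hx hy =>
    obtain ⟨c, hc, t, rfl⟩ := hx
    obtain ⟨d, hd, s, rfl⟩ := hy
    obtain ⟨e, rfl⟩ | ⟨e, rfl⟩ := ValuationRing.dvd_total c d
    · exact ⟨c, hc, t + f e * s, by rw [map_mul]; ring⟩
    · exact ⟨d, hd, f e * t + s, by rw [map_mul]; ring⟩

/-- If `V ⊆ V'` is an extension of valuation rings with `V'` ind-smooth over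
`V`, then for any prime ideals `q1 ⊆ q2` of `V` with no prime of `V` strictly between them, the
induced extension `V_{q2}/q1·V_{q2} ⊆ V'_{q2V'}/q1·V'_{q2V'}` of valuation rings is ind-smooth. -/
theorem isIndSmooth_extension_inducedQuotLocMap
    (V : Type u) (V' : Type v) [CommRing V] [IsDomain V] [ValuationRing V]
    [CommRing V'] [IsDomain V'] [ValuationRing V'] [Algebra V V']
    (hinj : Function.Injective (algebraMap V V'))
    [IsLocalHom (algebraMap V V')]
    (hsm : (algebraMap V V').IsIndSmooth)
    (q1 q2 : Ideal V) [q1.IsPrime] [q2.IsPrime] (hle : q1 ≤ q2)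
    (hbetween : ∀ p : Ideal V, p.IsPrime → ¬(q1 < p ∧ p < q2))
    [(q2.map (algebraMap V V')).IsPrime]
    (hc : q2 = (q2.map (algebraMap V V')).comap (algebraMap V V')) :
    (inducedQuotLocMap V V' q1 q2 hc).IsIndSmooth := by
  let B := Localization.AtPrime (q2.map (algebraMap V V'))
  let A' := Localization.AtPrime q2 ⧸ q1.map (algebraMap V (Localization.AtPrime q2))
  let B' := B ⧸ q1.map ((algebraMap V' B).comp (algebraMap V V'))
  let : Algebra A' B' := (inducedQuotLocMap V V' q1 q2 hc).toAlgebra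
  have : IsScalarTower V A' B' := IsScalarTower.of_algebraMap_eq fun x => by
    change _ = inducedQuotLocMap V V' q1 q2 hc (Ideal.Quotient.mk _ (algebraMap V _ x))
    rw [inducedQuotLocMap, Ideal.quotientMap_mk, Localization.localRingHom_to_map]
    rfl
  have hB : (algebraMap V B).IsIndSmooth :=
    hsm.of_isLocalization _ (Ideal.primeCompl_le_nonZeroDivisors (q2.map (algebraMap V V')))
  refine hB.of_surjective (A' := A') (B' := B') (Ideal.Quotient.mkₐ V _)
    (Ideal.Quotient.mkₐ_surjective V _) (fun b hb => ?_) (fun x => ?_)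
  · obtain ⟨c, hc1, t, ht⟩ :=
      ValuationRing.exists_eq_mul_of_mem_map _ q1 (Ideal.Quotient.eq_zero_iff_mem.mp hb)
    exact ⟨c, t, Ideal.Quotient.eq_zero_iff_mem.mpr (Ideal.mem_map_of_mem _ hc1), ht⟩
  · obtain ⟨x, rfl⟩ := Ideal.Quotient.mk_surjective x
    obtain ⟨⟨a, s⟩, has⟩ := IsLocalization.surj q2.primeCompl x
    refine ⟨s, a, (IsLocalization.map_units (Localization.AtPrime q2) s).map
      (Ideal.Quotient.mk _), ?_⟩
    change Ideal.Quotient.mk _ (algebraMap V _ a) =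
      Ideal.Quotient.mk _ (algebraMap V _ (s : V)) * Ideal.Quotient.mk _ x
    rw [← map_mul, ← has, mul_comm]
end

section
/- Let V ⊆ V' be an extension of valuation rings containing ℚ (i.e., both are ℚ-algebras), with residue field extension k ⊆ k' and fraction field extension K ⊆ K'. Assume K' is a field extension of K of finite type, that the transcendence degree of K' over K equals the transcendence degree of k' over k and is finite, and that the value group extension of V ⊆ V' is trivial. Then V' is ind-smooth over V. -/
universe u v

/-- The transcendence degree of a commutative `R`-algebra `A`, as a cardinal: the supremum of the
cardinalities of the algebraically independent subsets of `A`. -/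
noncomputable def trdegC (R A : Type*) [CommRing R] [CommRing A] [Algebra R A] : Cardinal :=
  ⨆ s : { s : Set A // AlgebraicIndependent R ((↑) : s → A) }, Cardinal.mk s.1

namespace ValuationSubring

variable {G N : Type*} [Group G] [Finite G] [Field N] [MulSemiringAction G N]
  (U : ValuationSubring N)

/-- The valuation attached to `U` is invariant under `g`. -/
def Invariant (g : G) : Prop := ∀ x : N, U.valuation (g • x) = U.valuation x

variable {U}

omit [Finite G] in
lemma Invariant.one : U.Invariant (1 : G) := fun x ↦ by rw [one_smul]

omit [Finite G] in
lemma Invariant.mul {g h : G} (hg : U.Invariant g) (hh : U.Invariant h) :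
    U.Invariant (g * h) := fun x ↦ by rw [mul_smul, hg, hh]

omit [Finite G] in
lemma Invariant.inv {g : G} (hg : U.Invariant g) : U.Invariant g⁻¹ := fun x ↦ by
  rw [← hg, smul_inv_smul]

lemma invariant_of_forall_le_one {g : G}
    (h : ∀ x : N, U.valuation x ≤ 1 → U.valuation (g • x) ≤ 1) : U.Invariant g := by
  have mono : ∀ x y : N, U.valuation x ≤ U.valuation y →
      U.valuation (g • x) ≤ U.valuation (g • y) := by
    intro x y hxy
    rcases eq_or_ne y 0 with rfl | hy
    · have : x = 0 := by simpa using hxy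
      simp [this]
    have hy' : g • y ≠ 0 := (smul_ne_zero_iff_ne g).2 hy
    have h1 := h (x / y) (by
      rw [map_div₀]
      exact div_le_one_of_le₀ hxy zero_le)
    rw [smul_div₀', map_div₀] at h1
    exact (div_le_one₀ (by simpa [zero_lt_iff] using hy')).1 h1
  intro x
  obtain ⟨n, hn, hgn⟩ := isOfFinOrder_iff_pow_eq_one.1 (isOfFinOrder_of_finite g)
  obtain ⟨n, rfl⟩ := Nat.exists_eq_succ_of_ne_zero hn.ne'
  rcases le_total (U.valuation (g • x)) (U.valuation x) with hx | hx
  · refine le_antisymm hx ?_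
    have : ∀ k : ℕ, U.valuation (g ^ (k + 1) • x) ≤ U.valuation (g • x) := by
      intro k
      induction k with
      | zero => simp
      | succ k ih =>
        rw [pow_succ', mul_smul]
        exact mono _ _ (ih.trans hx)
    simpa [hgn] using this n
  · refine le_antisymm ?_ hx
    have : ∀ k : ℕ, U.valuation (g • x) ≤ U.valuation (g ^ (k + 1) • x) := by
      intro k
      induction k with
      | zero => simp
      | succ k ih =>
        rw [pow_succ', mul_smul]
        exact mono _ _ (hx.trans ih)
    simpa [hgn] using this n

lemma exists_lt_one_of_not_invariant {g : G} (hg : ¬ U.Invariant g) :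
    ∃ x : N, U.valuation x < 1 ∧ 1 < U.valuation (g • x) := by
  have key : ∀ g : G, ¬ U.Invariant g → ∃ x : N, U.valuation x ≤ 1 ∧ 1 < U.valuation (g • x) := by
    intro g hg
    by_contra! h
    exact hg (invariant_of_forall_le_one h)
  obtain ⟨x, hx, hgx⟩ := key g hg
  obtain ⟨y, hy, hgy⟩ := key g⁻¹ (fun h ↦ hg (by simpa using h.inv))
  refine ⟨x * (g⁻¹ • y)⁻¹, ?_, ?_⟩
  · rw [map_mul, map_inv₀]
    exact (mul_le_of_le_one_left' hx).trans_lt (inv_lt_one_of_one_lt₀ hgy)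
  · rw [smul_mul', smul_inv'', smul_inv_smul, map_mul, map_inv₀]
    have hy0 : y ≠ 0 := by
      rintro rfl
      simp at hgy
    refine hgx.trans_le (le_mul_of_one_le_right zero_le ((one_le_inv₀ ?_).2 hy))
    simpa [zero_lt_iff] using hy0

omit [Finite G] in
lemma smul_natCast' (g : G) (n : ℕ) : g • (n : N) = n :=
  map_natCast (MulSemiringAction.toRingHom G N g) n

lemma exists_nat_valuation_sub_eq_one (hU : ∀ n : ℕ, n ≠ 0 → U.valuation (n : N) = 1)
    {ι : Type*} [Finite ι] (f : ι → N) :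
    ∃ n : ℕ, n ≠ 0 ∧ ∀ i, U.valuation (f i) ≤ 1 → U.valuation ((n : N) - f i) = 1 := by
  have hfin : (({0} : Set ℕ) ∪ ⋃ i, {n : ℕ | U.valuation ((n : N) - f i) < 1}).Finite := by
    refine (Set.finite_singleton _).union (Set.finite_iUnion fun i ↦ Set.Subsingleton.finite ?_)
    have key : ∀ m n : ℕ, m < n → U.valuation ((m : N) - f i) < 1 →
        ¬ U.valuation ((n : N) - f i) < 1 := by
      intro m n hmn hm hn
      have := hU (n - m) (by omega)
      rw [Nat.cast_sub hmn.le, ← sub_sub_sub_cancel_right _ _ (f i)] at this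
      exact (U.valuation.map_sub_lt hn hm).ne this
    intro m hm n hn
    rcases lt_trichotomy m n with h | h | h
    · exact (key m n h hm hn).elim
    · exact h
    · exact (key n m h hn hm).elim
  obtain ⟨n, hn⟩ := hfin.exists_notMem
  simp only [Set.mem_union, Set.mem_singleton_iff, Set.mem_iUnion, Set.mem_ofPred_eq, not_or,
    not_exists, not_lt] at hn
  exact ⟨n, hn.1, fun i hi ↦ le_antisymm (U.valuation.map_sub_le (hU n hn.1).le hi) (hn.2 i)⟩

lemma exists_separating (hU : ∀ n : ℕ, n ≠ 0 → U.valuation (n : N) = 1) {g : G}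
    (hg : ¬ U.Invariant g) :
    ∃ b : N, (∀ k : G, U.valuation (k • b) ≤ 1) ∧ U.valuation (b - 1) < 1 ∧
      U.valuation (g • b) < 1 := by
  obtain ⟨x, hx, hgx⟩ := exists_lt_one_of_not_invariant hg
  obtain ⟨n, hn, h⟩ := exists_nat_valuation_sub_eq_one hU (fun k : G ↦ k • x)
  have hsm : ∀ k : G, k • ((n : N) / (n - x)) = n / (n - k • x) := fun k ↦ by
    rw [smul_div₀', smul_sub, smul_natCast']
  have hbig : ∀ k : G, 1 < U.valuation (k • x) →
      U.valuation ((n : N) - k • x) = U.valuation (k • x) := fun k hk ↦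
    U.valuation.map_sub_eq_of_lt_right (by rwa [hU n hn])
  refine ⟨n / (n - x), fun k ↦ ?_, ?_, ?_⟩
  · rw [hsm, map_div₀, hU n hn]
    rcases le_or_gt (U.valuation (k • x)) 1 with hk | hk
    · rw [h k hk]; simp
    · rw [hbig k hk]
      simpa using (inv_lt_one_of_one_lt₀ hk).le
  · have h1 : U.valuation ((n : N) - x) = 1 := by simpa using h 1 (by simpa using hx.le)
    have h0 : (n : N) - x ≠ 0 := by
      intro h0
      simp [h0] at h1
    rw [div_sub_one h0, map_div₀, h1]
    simpa using hx
  · rw [hsm, map_div₀, hU n hn, hbig g hgx]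
    simpa using inv_lt_one_of_one_lt₀ hgx

lemma valuation_eq_one_of_sub_one_lt {x : N} (h : U.valuation (x - 1) < 1) :
    U.valuation x = 1 := by
  have := U.valuation.map_add_eq_of_lt_right (x := x - 1) (y := 1) (by simpa using h)
  simpa using this

lemma valuation_prod_sub_one_lt {ι : Type*} (s : Finset ι) (f : ι → N)
    (h : ∀ i ∈ s, U.valuation (f i - 1) < 1) : U.valuation (∏ i ∈ s, f i - 1) < 1 := by
  classical
  induction s using Finset.induction_on with
  | empty => simp
  | insert i s hi ih =>
    rw [Finset.prod_insert hi]
    have h1 := ih fun j hj ↦ h j (Finset.mem_insert_of_mem hj)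
    have h2 := h i (Finset.mem_insert_self _ _)
    have : f i * ∏ j ∈ s, f j - 1 = f i * (∏ j ∈ s, f j - 1) + (f i - 1) := by ring
    rw [this]
    refine U.valuation.map_add_lt ?_ h2
    rwa [map_mul, valuation_eq_one_of_sub_one_lt h2, one_mul]

lemma valuation_prod_lt_one {ι : Type*} {s : Finset ι} {f : ι → N}
    (h : ∀ i ∈ s, U.valuation (f i) ≤ 1) {j : ι} (hj : j ∈ s) (hlt : U.valuation (f j) < 1) :
    U.valuation (∏ i ∈ s, f i) < 1 := by
  classical
  rw [← Finset.mul_prod_erase _ _ hj, map_mul, map_prod]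
  refine mul_lt_one_of_lt_of_le hlt (Finset.prod_le_one' fun i hi ↦ h i (Finset.mem_of_mem_erase hi))

variable (G) in
lemma exists_approx_idempotent (hU : ∀ n : ℕ, n ≠ 0 → U.valuation (n : N) = 1) :
    ∃ b : N, (∀ k : G, U.valuation (k • b) ≤ 1) ∧ U.valuation (b - 1) < 1 ∧
      ∀ g : G, ¬ U.Invariant g → U.valuation (g • b) < 1 := by
  classical
  have := Fintype.ofFinite G
  choose! b hb using fun (g : G) (hg : ¬ U.Invariant g) ↦ exists_separating hU hg
  have hmem : ∀ g : G, g ∈ Finset.univ.filter (fun g : G ↦ ¬ U.Invariant g) ↔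
    ¬ U.Invariant g := by simp
  refine ⟨∏ g ∈ Finset.univ.filter (fun g : G ↦ ¬ U.Invariant g), b g, fun k ↦ ?_, ?_,
    fun g hg ↦ ?_⟩
  · rw [Finset.smul_prod', map_prod]
    exact Finset.prod_le_one' fun i hi ↦ (hb i ((hmem i).1 hi)).1 k
  · exact valuation_prod_sub_one_lt _ _ fun i hi ↦ (hb i ((hmem i).1 hi)).2.1
  · rw [Finset.smul_prod']
    exact valuation_prod_lt_one (fun i hi ↦ (hb i ((hmem i).1 hi)).1 g) ((hmem g).2 hg)
      (hb g hg).2.2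

variable (G) in
lemma exists_mul_valuation_smul_le_one (hU : ∀ n : ℕ, n ≠ 0 → U.valuation (n : N) = 1) {w : N}
    (hw : U.valuation w ≤ 1) :
    ∃ t : N, (∀ k : G, U.valuation (k • t) ≤ 1) ∧ (∀ k : G, U.valuation (k • (t * w)) ≤ 1) ∧
      U.valuation t = 1 ∧ ∀ h : G, h • w = w → h • t = t := by
  obtain ⟨n, hn, h⟩ := exists_nat_valuation_sub_eq_one hU (fun k : G ↦ k • w)
  have hsm : ∀ k : G, k • ((n : N) - w)⁻¹ = (n - k • w)⁻¹ := fun k ↦ by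
    rw [smul_inv'', smul_sub, smul_natCast']
  have hbig : ∀ k : G, 1 < U.valuation (k • w) →
      U.valuation ((n : N) - k • w) = U.valuation (k • w) := fun k hk ↦
    U.valuation.map_sub_eq_of_lt_right (by rwa [hU n hn])
  refine ⟨(n - w)⁻¹, fun k ↦ ?_, fun k ↦ ?_, ?_, fun k hk ↦ ?_⟩
  · rw [hsm, map_inv₀]
    rcases le_or_gt (U.valuation (k • w)) 1 with hk | hk
    · rw [h k hk]; simp
    · rw [hbig k hk]
      exact (inv_lt_one_of_one_lt₀ hk).le
  · rw [smul_mul', hsm, map_mul, map_inv₀]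
    rcases le_or_gt (U.valuation (k • w)) 1 with hk | hk
    · rw [h k hk]; simpa using hk
    · rw [hbig k hk, inv_mul_cancel₀ (by rintro h0; simp [h0] at hk)]
  · rw [map_inv₀, inv_eq_one]
    simpa using h 1 (by simpa using hw)
  · rw [hsm, hk]

lemma residue_eq_zero_iff_valuation_lt_one (x : U) :
    IsLocalRing.residue U x = 0 ↔ U.valuation (x : N) < 1 := by
  rw [IsLocalRing.residue_eq_zero_iff, U.valuation_lt_one_iff]

/-- Independence of characters, for residues of multiplicative maps. -/
lemma valuation_sum_filter_lt_one {ι : Type*} [Fintype ι] (M : Submonoid N) (f : ι → N →* N)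
    (hf : ∀ i, ∀ x ∈ M, U.valuation (f i x) ≤ 1) (c : ι → N) (hc : ∀ i, U.valuation (c i) ≤ 1)
    (hsum : ∀ x ∈ M, U.valuation (∑ i, c i * f i x) < 1) (j : ι) (s : Finset ι)
    (hs : ∀ i, i ∈ s ↔ ∀ x ∈ M, U.valuation (f i x - f j x) < 1) :
    U.valuation (∑ i ∈ s, c i) < 1 := by
  classical
  let F : ι → M →* IsLocalRing.ResidueField U := fun i ↦
    (IsLocalRing.residue U : U →* _).comp
      { toFun := fun x ↦ ⟨f i x, (U.valuation_le_one_iff _).1 (hf i x x.2)⟩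
        map_one' := by ext; simp
        map_mul' := fun x y ↦ by ext; simp }
  let C : ι → U := fun i ↦ ⟨c i, (U.valuation_le_one_iff _).1 (hc i)⟩
  have hF : ∀ i, ∀ x : M, F i x = IsLocalRing.residue U
    ⟨f i x, (U.valuation_le_one_iff _).1 (hf i x x.2)⟩ := fun i x ↦ rfl
  let φ : (M →* IsLocalRing.ResidueField U) →₀ IsLocalRing.ResidueField U :=
    ∑ i, Finsupp.single (F i) (IsLocalRing.residue U (C i))
  have hφ : φ = 0 := by
    refine linearIndependent_iff.1
      (linearIndependent_monoidHom M (IsLocalRing.ResidueField U)) φ ?_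
    simp only [φ, map_sum, Finsupp.linearCombination_single]
    funext x
    rw [Finset.sum_apply]
    simp only [Pi.smul_apply, smul_eq_mul, Pi.zero_apply, hF]
    simp only [← map_mul, ← map_sum]
    rw [residue_eq_zero_iff_valuation_lt_one]
    simpa [C] using hsum x x.2
  have h2 : ∑ i ∈ s, IsLocalRing.residue U (C i) = 0 := by
    have := DFunLike.congr_fun hφ (F j)
    simp only [φ, Finsupp.finsetSum_apply, Finsupp.single_apply, Finsupp.coe_zero,
      Pi.zero_apply] at this
    rw [← Finset.sum_filter] at this
    convert this using 2
    ext i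
    rw [hs]
    simp only [Finset.mem_filter, Finset.mem_univ, true_and]
    rw [DFunLike.ext_iff]
    simp only [hF, Subtype.forall]
    refine forall₂_congr fun x hx ↦ ?_
    rw [← sub_eq_zero, ← map_sub, residue_eq_zero_iff_valuation_lt_one]
    rfl
  rw [← map_sum, residue_eq_zero_iff_valuation_lt_one] at h2
  simpa [C] using h2

variable (U) in
/-- The action of `g` on `U` is trivial modulo the maximal ideal. -/
def Inertial (g : G) : Prop := ∀ x : N, U.valuation x ≤ 1 → U.valuation (g • x - x) < 1

lemma Inertial.invariant {g : G} (hg : U.Inertial g) : U.Invariant g :=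
  invariant_of_forall_le_one fun x hx ↦ by
    simpa using U.valuation.map_add_le (hg x hx).le hx

lemma exists_invariant_of_fixed_by_inertia (hU : ∀ n : ℕ, n ≠ 0 → U.valuation (n : N) = 1)
    {y : N} (hy0 : y ≠ 0) (hy : ∀ g : G, U.Inertial g → g • y = y) :
    ∃ z : N, U.valuation z = U.valuation y ∧ ∀ g : G, U.Invariant g → g • z = z := by
  classical
  have := Fintype.ofFinite G
  let D := {g : G // U.Invariant g}
  by_contra! hcon
  have hsum : ∀ x ∈ U.toSubring.toSubmonoid,
      U.valuation (∑ d : D, ((d : G) • y / y) * (d : G) • x) < 1 := by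
    intro x hx
    have hx' : U.valuation x ≤ 1 := (U.valuation_le_one_iff x).2 hx
    have hle : U.valuation (∑ d : D, ((d : G) • y / y) * (d : G) • x) ≤ 1 := by
      refine U.valuation.map_sum_le fun d _ ↦ ?_
      rw [map_mul, map_div₀, d.2 y, d.2 x, div_self (by simpa using hy0), one_mul]
      exact hx'
    refine lt_of_le_of_ne hle fun h1 ↦ ?_
    obtain ⟨g, hg, hgz⟩ := hcon (∑ d : D, (d : G) • (y * x)) (by
      have : ∑ d : D, (d : G) • (y * x) = y * ∑ d : D, ((d : G) • y / y) * (d : G) • x := by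
        rw [Finset.mul_sum]
        refine Finset.sum_congr rfl fun d _ ↦ ?_
        rw [smul_mul']
        field_simp
      rw [this, map_mul, h1, mul_one])
    refine hgz ?_
    rw [Finset.smul_sum]
    refine Fintype.sum_equiv ⟨fun d ↦ ⟨g * d, hg.mul d.2⟩, fun d ↦ ⟨g⁻¹ * d, hg.inv.mul d.2⟩,
      fun d ↦ ?_, fun d ↦ ?_⟩ _ _ fun d ↦ ?_
    · simp
    · simp
    · simp [mul_smul]
  let s : Finset D := Finset.univ.filter fun d ↦ U.Inertial (d : G)
  have h1s : (⟨1, Invariant.one⟩ : D) ∈ s := by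
    simp [s, Inertial]
  have key := valuation_sum_filter_lt_one U.toSubring.toSubmonoid
    (fun d : D ↦ (MulSemiringAction.toRingHom G N (d : G) : N →* N))
    (fun d x hx ↦ by
      have hx' : U.valuation x ≤ 1 := (U.valuation_le_one_iff x).2 hx
      exact (d.2 x).trans_le hx')
    (fun d ↦ (d : G) • y / y)
    (fun d ↦ by rw [map_div₀, d.2 y, div_self (by simpa using hy0)])
    (by simpa using hsum) ⟨1, Invariant.one⟩ s
    (fun d ↦ by
      rw [Finset.mem_filter_univ]
      refine forall_congr' fun x ↦ ?_
      rw [U.valuation_le_one_iff]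
      simp)
  rw [Finset.sum_congr rfl (g := fun _ ↦ (1 : N)) (fun d hd ↦ by
    rw [hy d (Finset.mem_filter.1 hd).2, div_self hy0])] at key
  rw [Finset.sum_const, nsmul_one, hU _ (Finset.card_ne_zero_of_mem h1s)] at key
  exact lt_irrefl _ key

open Polynomial in
lemma exists_fixed_of_separated (hU : ∀ n : ℕ, n ≠ 0 → U.valuation (n : N) = 1)
    {z : N} (hz0 : z ≠ 0) (hz : ∀ g : G, U.Invariant g → g • z = z)
    (hsep : ∀ g : G, ¬ U.Invariant g → U.valuation (g • z) ≠ U.valuation z) :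
    ∃ c : N, (∀ g : G, g • c = c) ∧ U.valuation c = U.valuation z := by
  classical
  have := Fintype.ofFinite G
  have hvz : U.valuation z ≠ 0 := U.valuation.ne_zero_iff.2 hz0
  have hgz0 : ∀ g : G, g • z ≠ 0 := fun g ↦ (smul_ne_zero_iff_ne _).2 hz0
  have factor : ∀ g : G, ∃ (A : N) (F : U[X]) (i j k : ℕ), A ≠ 0 ∧
      C z * X - C (g • z) = C A * F.map (algebraMap U N) ∧
      F.map (IsLocalRing.residue U) = X ^ i * (X - C 1) ^ j * (-1) ^ k ∧ (g = 1 → j ≠ 0) := by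
    intro g
    by_cases hg : U.Invariant g
    · refine ⟨z, X - C 1, 0, 1, 0, hz0, ?_, by simp, by simp⟩
      rw [hz g hg]
      simp [mul_sub]
    have hg1 : g = 1 → False := fun h ↦ hg (h ▸ Invariant.one)
    rcases lt_or_gt_of_ne (hsep g hg) with h | h
    · have hv : U.valuation (g • z / z) < 1 := by
        rw [map_div₀]
        exact (div_lt_one₀ (zero_lt_iff.2 hvz)).2 h
      refine ⟨z, X - C ⟨g • z / z, (U.valuation_le_one_iff _).1 hv.le⟩, 1, 0, 0, hz0, ?_, ?_,
        fun h ↦ (hg1 h).elim⟩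
      · rw [Polynomial.map_sub, map_X, map_C, mul_sub, ← C_mul]
        congr 2
        change _ = z * (g • z / z)
        field_simp
      · rw [Polynomial.map_sub, map_X, map_C, (residue_eq_zero_iff_valuation_lt_one _).2 hv]
        simp
    · have hv : U.valuation (z / g • z) < 1 := by
        rw [map_div₀]
        exact (div_lt_one₀ (zero_lt_iff.2 (U.valuation.ne_zero_iff.2 (hgz0 g)))).2 h
      refine ⟨g • z, C ⟨z / g • z, (U.valuation_le_one_iff _).1 hv.le⟩ * X - C 1, 0, 0, 1,
        hgz0 g, ?_, ?_, fun h ↦ (hg1 h).elim⟩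
      · rw [Polynomial.map_sub, Polynomial.map_mul, map_X, map_C, map_C, mul_sub, ← C_mul,
          ← mul_assoc, ← C_mul]
        congr 3
        · change _ = g • z * (z / g • z)
          have := hgz0 g
          field_simp
        · simp
      · rw [Polynomial.map_sub, Polynomial.map_mul, map_X, map_C, map_C,
          (residue_eq_zero_iff_valuation_lt_one _).2 hv]
        simp
  choose A F i j k hA hAF hF hj using factor
  have hAprod : ∏ g, A g ≠ 0 := Finset.prod_ne_zero_iff.2 fun g _ ↦ hA g
  let P := MulSemiringAction.charpoly G z
  have hcoeff : ∀ n, P.coeff n * z ^ n = (∏ g, A g) * ((∏ g, F g).coeff n : U) := by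
    intro n
    have h1 : P.comp (C z * X) = C (∏ g, A g) * (∏ g, F g).map (algebraMap U N) := by
      simp only [P, MulSemiringAction.charpoly_eq, Polynomial.prod_comp, sub_comp, X_comp, C_comp, hAF,
        Finset.prod_mul_distrib, map_prod, Polynomial.map_prod]
    have h2 := congr_arg (fun Q ↦ Q.coeff n) h1
    rw [comp_C_mul_X_coeff, coeff_C_mul, coeff_map] at h2
    exact h2
  have hres : (∏ g, F g).map (IsLocalRing.residue U) =
      X ^ (∑ g, i g) * ((X - C 1) ^ (∑ g, j g) * (-1) ^ (∑ g, k g)) := by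
    rw [Polynomial.map_prod]
    simp only [hF, Finset.prod_mul_distrib, Finset.prod_pow_eq_pow_sum, mul_assoc]
  have hm : ∑ g, j g ≠ 0 := by
    intro h
    exact hj 1 rfl (Finset.sum_eq_zero_iff.1 h 1 (Finset.mem_univ _))
  set s := ∑ g, i g
  set m := ∑ g, j g
  have hneg : ((-1 : (IsLocalRing.ResidueField U)[X]) ^ (∑ g, k g)) =
      C ((-1) ^ (∑ g, k g)) := by simp
  have hsign : ((-1 : IsLocalRing.ResidueField U) ^ (∑ g, k g)) ≠ 0 :=
    pow_ne_zero _ (neg_ne_zero.2 one_ne_zero)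
  have unit : ∀ n, ((∏ g, F g).map (IsLocalRing.residue U)).coeff n ≠ 0 →
      U.valuation (P.coeff n * z ^ n) = U.valuation (∏ g, A g) := by
    intro n hn
    rw [coeff_map, Ne, residue_eq_zero_iff_valuation_lt_one, not_lt] at hn
    rw [hcoeff, map_mul, le_antisymm (U.valuation_le_one _) hn, mul_one]
  have h0 := unit s (by
    rw [hres, hneg, coeff_X_pow_mul', if_pos le_rfl, coeff_mul_C, sub_eq_add_neg X, ← C_neg,
      coeff_X_add_C_pow]
    refine mul_ne_zero ?_ hsign
    simp)
  have h1 := unit (s + 1) (by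
    rw [hres, hneg, coeff_X_pow_mul', if_pos (Nat.le_succ _), coeff_mul_C, sub_eq_add_neg X, ← C_neg,
      coeff_X_add_C_pow,
      Nat.add_sub_cancel_left, Nat.choose_one_right]
    refine mul_ne_zero (mul_ne_zero (pow_ne_zero _ (neg_ne_zero.2 one_ne_zero)) ?_) hsign
    rw [← map_natCast (IsLocalRing.residue U), Ne, residue_eq_zero_iff_valuation_lt_one]
    simp [hU m hm])
  have hfix : ∀ (g : G) n, g • P.coeff n = P.coeff n := fun g n ↦ by
    rw [← Polynomial.coeff_smul, MulSemiringAction.smul_charpoly]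
  have hA' : U.valuation (∏ g, A g) ≠ 0 := U.valuation.ne_zero_iff.2 hAprod
  have h1' : U.valuation (P.coeff (s + 1)) ≠ 0 := by
    rintro h
    rw [map_mul, h, zero_mul] at h1
    exact hA' h1.symm
  refine ⟨P.coeff s / P.coeff (s + 1), fun g ↦ by rw [smul_div₀', hfix, hfix], ?_⟩
  rw [map_div₀, div_eq_iff h1']
  rw [← h1, map_mul, map_mul, map_pow, map_pow, pow_succ', ← mul_assoc] at h0
  rw [mul_comm (U.valuation z)]
  exact mul_right_cancel₀ (pow_ne_zero _ hvz) h0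

lemma exists_fixed_valuation_eq (hU : ∀ n : ℕ, n ≠ 0 → U.valuation (n : N) = 1)
    {y : N} (hy : ∀ g : G, U.Inertial g → g • y = y) :
    ∃ c : N, (∀ g : G, g • c = c) ∧ U.valuation c = U.valuation y := by
  classical
  have := Fintype.ofFinite G
  rcases eq_or_ne y 0 with rfl | hy0
  · exact ⟨0, by simp, rfl⟩
  obtain ⟨z, hzy, hz⟩ := exists_invariant_of_fixed_by_inertia hU hy0 hy
  have hz0 : z ≠ 0 := by
    rintro rfl
    exact hy0 (by simpa using hzy.symm)
  obtain ⟨b, hb, hb1, hbg⟩ := exists_approx_idempotent G hU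
  let D := {g : G // U.Invariant g}
  let e : N := ∏ d : D, (d : G) • b
  have hvb := valuation_eq_one_of_sub_one_lt hb1
  have he : U.valuation e = 1 := by
    simp only [e, map_prod]
    exact Finset.prod_eq_one fun d _ ↦ by rw [d.2 b, hvb]
  have he0 : e ≠ 0 := U.valuation.ne_zero_iff.1 (by simp [he])
  have hefix : ∀ g : G, U.Invariant g → g • e = e := by
    intro g hg
    simp only [e]
    rw [Finset.smul_prod']
    refine Fintype.prod_equiv ⟨fun d ↦ ⟨g * d, hg.mul d.2⟩, fun d ↦ ⟨g⁻¹ * d, hg.inv.mul d.2⟩,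
      fun d ↦ ?_, fun d ↦ ?_⟩ _ _ fun d ↦ ?_
    · simp
    · simp
    · simp [mul_smul]
  have heg : ∀ g : G, ¬ U.Invariant g → U.valuation (g • e) < 1 := by
    intro g hg
    simp only [e]
    rw [Finset.smul_prod']
    refine valuation_prod_lt_one (j := ⟨1, Invariant.one⟩) (fun d _ ↦ ?_) (Finset.mem_univ _) ?_
    · rw [← mul_smul]
      exact hb _
    · simpa using hbg g hg
  have hfin : (⋃ g : {g : G // ¬ U.Invariant g},
      {m : ℕ | U.valuation ((g : G) • (z * e ^ m)) = U.valuation z}).Finite := by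
    refine Set.finite_iUnion fun g ↦ Set.Subsingleton.finite ?_
    have h1 : ∀ m, U.valuation ((g : G) • (z * e ^ m)) =
        U.valuation ((g : G) • z) * U.valuation ((g : G) • e) ^ m := fun m ↦ by
      rw [smul_mul', smul_pow', map_mul, map_pow]
    have h2 : U.valuation ((g : G) • z) ≠ 0 :=
      (U.valuation.ne_zero_iff).2 ((smul_ne_zero_iff_ne _).2 hz0)
    have h3 : 0 < U.valuation ((g : G) • e) :=
      zero_lt_iff.2 ((U.valuation.ne_zero_iff).2 ((smul_ne_zero_iff_ne _).2 he0))
    intro m hm n hn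
    simp only [Set.mem_ofPred_eq, h1] at hm hn
    exact pow_right_injective₀ h3 (heg g g.2).ne (mul_left_cancel₀ h2 (hm.trans hn.symm))
  obtain ⟨m, hm⟩ := hfin.exists_notMem
  simp only [Set.mem_iUnion, Set.mem_ofPred_eq, not_exists, Subtype.forall] at hm
  have hv : U.valuation (z * e ^ m) = U.valuation z := by simp [he]
  obtain ⟨c, hc, hcz⟩ := exists_fixed_of_separated (G := G) (z := z * e ^ m) hU
    (mul_ne_zero hz0 (pow_ne_zero _ he0))
    (fun g hg ↦ by rw [smul_mul', smul_pow', hz g hg, hefix g hg])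
    (fun g hg ↦ by rw [hv]; exact hm g hg)
  exact ⟨c, hc, by rw [hcz, hv, hzy]⟩

lemma Inertial.mul {g h : G} (hg : U.Inertial g) (hh : U.Inertial h) :
    U.Inertial (g * h) := fun x hx ↦ by
  have : (g * h) • x - x = g • (h • x - x) + (g • x - x) := by
    rw [smul_sub, mul_smul]; ring
  rw [this]
  exact U.valuation.map_add_lt (by rw [hg.invariant]; exact hh x hx) (hg x hx)

lemma Inertial.inv {g : G} (hg : U.Inertial g) : U.Inertial g⁻¹ := fun x hx ↦ by
  have : g⁻¹ • x - x = g⁻¹ • (x - g • x) := by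
    rw [smul_sub, inv_smul_smul]
  rw [this, hg.invariant.inv, U.valuation.map_sub_swap]
  exact hg x hx

section Subgroup

variable {H : Subgroup G}

/-- In residue characteristic zero, an extension without ramification is fixed by inertia. -/
lemma smul_eq_of_inertial (hU : ∀ n : ℕ, n ≠ 0 → U.valuation (n : N) = 1)
    (hval : ∀ x : N, (∀ h ∈ H, h • x = x) →
      ∃ c : N, (∀ g : G, g • c = c) ∧ U.valuation c = U.valuation x)
    {g : G} (hg : U.Inertial g) {y : N} (hy : ∀ h ∈ H, h • y = y) : g • y = y := by
  classical
  have := Fintype.ofFinite G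
  let I := {g : G // U.Inertial g}
  have hne : Nonempty I := ⟨⟨1, fun x _ ↦ by simp⟩⟩
  have hcard : Fintype.card I ≠ 0 := Fintype.card_ne_zero
  have hcardN : (Fintype.card I : N) ≠ 0 :=
    U.valuation.ne_zero_iff.1 (by rw [hU _ hcard]; exact one_ne_zero)
  set n := Fintype.card I
  let y' : N := ∑ i : I, (i : G) • y
  have hfix : ∀ g : G, U.Inertial g → g • y' = y' := by
    intro g hg
    simp only [y']
    rw [Finset.smul_sum]
    refine Fintype.sum_equiv ⟨fun d ↦ ⟨g * d, hg.mul d.2⟩, fun d ↦ ⟨g⁻¹ * d, hg.inv.mul d.2⟩,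
      fun d ↦ ?_, fun d ↦ ?_⟩ _ _ fun d ↦ ?_
    · simp
    · simp
    · simp [mul_smul]
  let w : N := n * y - y'
  have hw : w = 0 := by
    by_contra hw0
    obtain ⟨c, hc, hcw⟩ := exists_fixed_valuation_eq (G := H) hU (y := w) (by
      intro h hh
      have h1 : (h : G) • y' = y' := hfix _ hh
      have h2 : (h : G) • y = y := hy _ h.2
      simp only [w]
      rw [Subgroup.smul_def, smul_sub, smul_mul', h1, h2, smul_natCast'])
    obtain ⟨c', hc', hcc'⟩ := hval c (fun h hh ↦ hc ⟨h, hh⟩)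
    rw [hcw] at hcc'
    have hc0 : c' ≠ 0 := U.valuation.ne_zero_iff.1 (by
      rw [hcc']; exact U.valuation.ne_zero_iff.2 hw0)
    have hu : U.valuation (w / c') = 1 := by
      rw [map_div₀, hcc', div_self (U.valuation.ne_zero_iff.2 hw0)]
    have hsum : ∑ i : I, (i : G) • (w / c') = 0 := by
      have : ∀ i : I, (i : G) • (w / c') = (n * (i : G) • y - y') / c' := fun i ↦ by
        rw [smul_div₀', hc', smul_sub, smul_mul', smul_natCast', hfix i i.2]
      simp only [this, ← Finset.sum_div, Finset.sum_sub_distrib, ← Finset.mul_sum]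
      simp [y', n]
    have hlt : U.valuation (∑ i : I, ((i : G) • (w / c') - w / c')) < 1 :=
      U.valuation.map_sum_lt one_ne_zero fun i _ ↦ i.2 _ hu.le
    rw [Finset.sum_sub_distrib, hsum, Finset.sum_const, Finset.card_univ, zero_sub,
      Valuation.map_neg, nsmul_eq_mul, map_mul, hu, hU _ hcard] at hlt
    simp at hlt
  have hy' : y = y' / n := by
    rw [eq_div_iff hcardN, mul_comm]
    exact sub_eq_zero.1 hw
  rw [hy', smul_div₀', hfix g hg, smul_natCast']

/-- The decomposition group surjects onto the automorphisms of the residue field. -/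
lemma exists_inertial_of_residually_trivial (hU : ∀ n : ℕ, n ≠ 0 → U.valuation (n : N) = 1)
    {d : G} (hd : U.Invariant d)
    (hres : ∀ x : N, (∀ h ∈ H, h • x = x) → U.valuation x ≤ 1 → U.valuation (d • x - x) < 1) :
    ∃ h ∈ H, U.Inertial (h⁻¹ * d) := by
  classical
  have := Fintype.ofFinite G
  obtain ⟨b, hb, hb1, hbg⟩ := exists_approx_idempotent G hU
  let M : Submonoid N :=
    { carrier := {x | ∀ k : G, U.valuation (k • x) ≤ 1}
      one_mem' := fun k ↦ by simp
      mul_mem' := fun {x y} hx hy k ↦ by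
        rw [smul_mul', map_mul]; exact mul_le_one' (hx k) (hy k) }
  let E := {h : H // U.Invariant (h : G)}
  let m : E ⊕ E → G := Sum.elim (fun h ↦ (h : G)) (fun h ↦ d * h)
  let c : E ⊕ E → N := Sum.elim (fun _ ↦ 1) (fun _ ↦ -1)
  let e1 : E := ⟨1, Invariant.one⟩
  have hsum : ∀ x ∈ M, U.valuation (∑ i, c i * m i • x) < 1 := by
    intro x hx
    let X : N := ∑ h : H, (h : G) • (x * b)
    have hX : U.valuation (X - ∑ h : E, (h : G) • x) < 1 := by
      have : X - ∑ h : E, (h : G) • x =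
          ∑ h : H, ((h : G) • (x * b) - if U.Invariant (h : G) then (h : G) • x else 0) := by
        rw [Finset.sum_sub_distrib, ← Finset.sum_filter]
        congr 1
        exact (Finset.sum_subtype _ (by simp) (fun h : H ↦ (h : G) • x)).symm
      rw [this]
      refine U.valuation.map_sum_lt one_ne_zero fun h _ ↦ ?_
      split_ifs with hh
      · have : (h : G) • (x * b) - (h : G) • x = (h : G) • x * (h : G) • (b - 1) := by
          rw [smul_mul', smul_sub, smul_one]; ring
        rw [this, map_mul, hh (b - 1)]
        exact (mul_le_of_le_one_left' (hx h)).trans_lt hb1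
      · rw [sub_zero, smul_mul', map_mul]
        exact (mul_le_of_le_one_left' (hx h)).trans_lt (hbg h hh)
    have hXfix : ∀ h ∈ H, h • X = X := by
      intro h hh
      simp only [X]
      rw [Finset.smul_sum]
      exact Fintype.sum_equiv (Equiv.mulLeft (⟨h, hh⟩ : H)) _ _ fun k ↦ by simp [mul_smul]
    have hX1 : U.valuation X ≤ 1 := U.valuation.map_sum_le fun h _ ↦ by
      rw [smul_mul', map_mul]; exact mul_le_one' (hx h) (hb h)
    have h1 := hres X hXfix hX1
    have h2 : U.valuation (d • (X - ∑ h : E, (h : G) • x)) < 1 := by rwa [hd]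
    have : ∑ i, c i * m i • x = d • (X - ∑ h : E, (h : G) • x) - (X - ∑ h : E, (h : G) • x)
        - (d • X - X) := by
      simp only [Fintype.sum_sum_type, c, m, Sum.elim_inl, Sum.elim_inr, one_mul, neg_mul,
        Finset.sum_neg_distrib, mul_smul, smul_sub, Finset.smul_sum]
      ring
    rw [this]
    exact U.valuation.map_sub_lt (U.valuation.map_sub_lt h2 hX) h1
  let s : Finset (E ⊕ E) := Finset.univ.filter fun i ↦
    ∀ x ∈ M, U.valuation (m i • x - m (Sum.inr e1) • x) < 1
  have key := valuation_sum_filter_lt_one M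
    (fun i ↦ (MulSemiringAction.toRingHom G N (m i) : N →* N))
    (fun i x hx ↦ hx _) c (fun i ↦ by rcases i with i | i <;> simp [c]) hsum (Sum.inr e1) s
    (fun i ↦ by rw [Finset.mem_filter_univ]; rfl)
  have hex : ∃ h : E, Sum.inl h ∈ s := by
    by_contra! hcon
    have hc : ∀ i ∈ s, c i = -1 := by
      intro i hi
      rcases i with i | i
      · exact (hcon i hi).elim
      · rfl
    have h1s : Sum.inr e1 ∈ s := by simp [s]
    rw [Finset.sum_congr rfl hc, Finset.sum_const, nsmul_eq_mul, map_mul, Valuation.map_neg,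
      hU _ (Finset.card_ne_zero_of_mem h1s)] at key
    simp at key
  obtain ⟨h, hh⟩ := hex
  rw [Finset.mem_filter_univ] at hh
  have hhd : ∀ x ∈ M, U.valuation ((h : G) • x - d • x) < 1 := by
    intro x hx
    simpa [m, e1] using hh x hx
  refine ⟨h, (h : H).2, fun x hx ↦ ?_⟩
  obtain ⟨t, ht, htx, ht1, -⟩ := exists_mul_valuation_smul_le_one G hU hx
  have hdt : U.valuation (d • t) = 1 := by rw [hd, ht1]
  have hdt0 : d • t ≠ 0 := U.valuation.ne_zero_iff.1 (by rw [hdt]; exact one_ne_zero)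
  have h1 : U.valuation (d • x - (h : G) • x) < 1 := by
    have : d • x - (h : G) • x = (((h : G) • t - d • t) * (h : G) • x
        - ((h : G) • (t * x) - d • (t * x))) / d • t := by
      rw [eq_div_iff hdt0, smul_mul', smul_mul']; ring
    rw [this, map_div₀, hdt, div_one]
    refine U.valuation.map_sub_lt ?_ (hhd _ htx)
    rw [map_mul, h.2 x]
    exact (mul_le_of_le_one_right' hx).trans_lt (hhd _ ht)
  have : ((h : G)⁻¹ * d) • x - x = (h : G)⁻¹ • (d • x - (h : G) • x) := by
    rw [smul_sub, inv_smul_smul, mul_smul]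
  rw [this, h.2.inv]
  exact h1

lemma exists_fixed_idempotent (hU : ∀ n : ℕ, n ≠ 0 → U.valuation (n : N) = 1) :
    ∃ e : N, (∀ h ∈ H, h • e = e) ∧ (∀ k : G, U.valuation (k • e) ≤ 1) ∧
      U.valuation (e - 1) < 1 ∧
      ∀ g : G, (∀ h ∈ H, ¬ U.Invariant (g * h)) → U.valuation (g • e) < 1 := by
  classical
  have := Fintype.ofFinite G
  obtain ⟨b, hb, hb1, hbg⟩ := exists_approx_idempotent G hU
  have hk : ∀ k : G, k • (1 - ∏ h : H, (1 - (h : G) • b)) =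
      1 - ∏ h : H, (1 - (k * h) • b) := fun k ↦ by
    rw [smul_sub, smul_one, Finset.smul_prod']
    simp only [smul_sub, smul_one, mul_smul]
  have hle : ∀ k : G, U.valuation (1 - k • b) ≤ 1 := fun k ↦
    U.valuation.map_sub_le (by simp) (hb k)
  refine ⟨1 - ∏ h : H, (1 - (h : G) • b), fun h hh ↦ ?_, fun k ↦ ?_, ?_, fun g hg ↦ ?_⟩
  · rw [hk]
    congr 1
    exact Fintype.prod_equiv (Equiv.mulLeft (⟨h, hh⟩ : H)) _ _ fun k ↦ by simp
  · rw [hk]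
    refine U.valuation.map_sub_le (by simp) ?_
    rw [map_prod]
    exact Finset.prod_le_one' fun h _ ↦ hle _
  · rw [sub_sub_cancel_left, Valuation.map_neg]
    refine valuation_prod_lt_one (j := 1) (fun h _ ↦ hle _) (Finset.mem_univ _) ?_
    rw [U.valuation.map_sub_swap]
    simpa using hb1
  · rw [hk, U.valuation.map_sub_swap]
    refine valuation_prod_sub_one_lt _ _ fun h _ ↦ ?_
    rw [sub_sub_cancel_left, Valuation.map_neg]
    exact hbg _ (hg h h.2)

lemma valuation_rat_smul_le (hU : ∀ n : ℕ, n ≠ 0 → U.valuation (n : N) = 1) [CharZero N]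
    (q : ℚ) (x : N) : U.valuation (q • x) ≤ U.valuation x := by
  have h1 : ∀ z : ℤ, U.valuation (z : N) ≤ 1 := fun z ↦ by
    rw [U.valuation_le_one_iff]
    exact intCast_mem U z
  rw [Rat.smul_def, Rat.cast_def, map_mul, map_div₀, hU _ q.den_nz, div_one]
  exact mul_le_of_le_one_left' (h1 _)

/-- If the invariants of `H` are unramified over those of `G`, they are generated by an element
which is separated by `U` from its other conjugates. -/
theorem exists_separated_generator (hU : ∀ n : ℕ, n ≠ 0 → U.valuation (n : N) = 1)
    (hH : ∀ g : G, (∀ x : N, (∀ h ∈ H, h • x = x) → g • x = x) → g ∈ H)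
    (hval : ∀ x : N, (∀ h ∈ H, h • x = x) →
      ∃ c : N, (∀ g : G, g • c = c) ∧ U.valuation c = U.valuation x) :
    ∃ a : N, (∀ h ∈ H, h • a = a) ∧ (∀ g : G, U.valuation (g • a) ≤ 1) ∧
      ∀ g : G, g ∉ H → U.valuation (g • a - a) = 1 := by
  classical
  have : CharZero N := charZero_of_inj_zero fun n hn ↦ by
    by_contra h0
    simpa [hn] using hU n h0
  obtain ⟨e, heH, he, he1, heg⟩ := exists_fixed_idempotent (H := H) hU
  have hinert : ∀ g : G, U.Inertial g → g ∈ H := fun g hg ↦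
    hH g fun x hx ↦ smul_eq_of_inertial hU hval hg hx
  have hdec : ∀ d : G, U.Invariant d → d ∉ H →
      ∃ x : N, (∀ h ∈ H, h • x = x) ∧ U.valuation x ≤ 1 ∧ 1 ≤ U.valuation (d • x - x) := by
    intro d hd hdH
    by_contra! hcon
    obtain ⟨h, hh, hi⟩ := exists_inertial_of_residually_trivial hU hd hcon
    exact hdH (by simpa using H.mul_mem hh (hinert _ hi))
  have hrat : ∀ (g : G) (q : ℚ) (x : N), g • (q • x) = q • g • x := fun g q x ↦
    map_rat_smul (MulSemiringAction.toRingHom G N g) q x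
  let C : Submodule ℚ N :=
    { carrier := {x | (∀ h ∈ H, h • x = x) ∧ ∀ k : G, U.valuation (k • x) ≤ 1}
      zero_mem' := by simp
      add_mem' := fun {x y} hx hy ↦ ⟨fun h hh ↦ by rw [smul_add, hx.1 h hh, hy.1 h hh],
        fun k ↦ by rw [smul_add]; exact U.valuation.map_add_le (hx.2 k) (hy.2 k)⟩
      smul_mem' := fun q x hx ↦ ⟨fun h hh ↦ by rw [hrat, hx.1 h hh],
        fun k ↦ by rw [hrat]; exact (valuation_rat_smul_le hU _ _).trans (hx.2 k)⟩ }
  have hC : ∀ x, x ∈ C ↔ (∀ h ∈ H, h • x = x) ∧ ∀ k : G, U.valuation (k • x) ≤ 1 :=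
    fun x ↦ Iff.rfl
  let B : Option {d : G // U.Invariant d ∧ d ∉ H} → Submodule ℚ C := fun i ↦ match i with
    | none =>
      { carrier := {x | U.valuation (x : N) < 1}
        zero_mem' := by simp
        add_mem' := fun {x y} hx hy ↦ U.valuation.map_add_lt hx hy
        smul_mem' := fun q x hx ↦ (valuation_rat_smul_le hU _ _).trans_lt hx }
    | some d =>
      { carrier := {x | U.valuation ((d : G) • (x : N) - x) < 1}
        zero_mem' := by simp
        add_mem' := fun {x y} hx hy ↦ by
          have : (d : G) • ((x + y : C) : N) - (x + y : C) =
              ((d : G) • (x : N) - x) + ((d : G) • (y : N) - y) := by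
            simp only [Submodule.coe_add, smul_add]; ring
          simp only [Set.mem_ofPred_eq, this]
          exact U.valuation.map_add_lt hx hy
        smul_mem' := fun q x hx ↦ by
          simp only [Set.mem_ofPred_eq, Submodule.coe_smul, hrat, ← smul_sub]
          exact (valuation_rat_smul_le hU _ _).trans_lt hx }
  have hBn : ∀ x, x ∈ B none ↔ U.valuation (x : N) < 1 := fun x ↦ Iff.rfl
  have hBs : ∀ d x, x ∈ B (some d) ↔ U.valuation ((d : G) • (x : N) - x) < 1 :=
    fun d x ↦ Iff.rfl
  have hBtop : ∀ i, B i ≠ ⊤ := by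
    intro i hi
    rcases i with _ | ⟨d, hd, hdH⟩
    · have h1 : (1 : N) ∈ C := by simp [hC]
      have : (⟨1, h1⟩ : C) ∈ B none := by rw [hi]; trivial
      simp [hBn] at this
    · obtain ⟨x, hxH, hx, hdx⟩ := hdec d hd hdH
      obtain ⟨t, ht, htx, ht1, htH⟩ := exists_mul_valuation_smul_le_one G hU hx
      have h1 : t ∈ C := ⟨fun h hh ↦ htH h (hxH h hh), ht⟩
      have h2 : t * x ∈ C := ⟨fun h hh ↦ by rw [smul_mul', htH h (hxH h hh), hxH h hh], htx⟩
      have h3 : (⟨t, h1⟩ : C) ∈ B (some ⟨d, hd, hdH⟩) := by rw [hi]; trivial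
      have h4 : (⟨t * x, h2⟩ : C) ∈ B (some ⟨d, hd, hdH⟩) := by rw [hi]; trivial
      rw [hBs] at h3 h4
      have h5 : t * (d • x - x) = (d • (t * x) - t * x) - (d • t - t) * d • x := by
        rw [smul_mul']; ring
      have h6 : U.valuation (t * (d • x - x)) < 1 := by
        rw [h5]
        refine U.valuation.map_sub_lt h4 ?_
        rw [map_mul, hd x]
        exact (mul_le_of_le_one_right' hx).trans_lt h3
      rw [map_mul, ht1, one_mul] at h6
      exact h6.not_ge hdx
  have hcov : ⋃ i, (B i : Set C) ≠ Set.univ := fun h ↦ by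
    obtain ⟨i, hi⟩ := Subspace.exists_eq_top_of_iUnion_eq_univ h
    exact hBtop i hi
  obtain ⟨⟨θ, hθ⟩, hθB⟩ := (Set.ne_univ_iff_exists_notMem _).1 hcov
  simp only [Set.mem_iUnion, not_exists, SetLike.mem_coe] at hθB
  obtain ⟨hθH, hθ1⟩ := (hC θ).1 hθ
  have hvθ : U.valuation θ = 1 :=
    le_antisymm (by simpa using hθ1 1) (not_lt.1 ((hBn _).not.1 (hθB none)))
  have hve : U.valuation e = 1 := valuation_eq_one_of_sub_one_lt he1
  have haH : ∀ h ∈ H, h • (e * θ) = e * θ := fun h hh ↦ by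
    rw [smul_mul', heH h hh, hθH h hh]
  refine ⟨e * θ, haH, fun g ↦ ?_, fun g hg ↦ ?_⟩
  · rw [smul_mul', map_mul]
    exact mul_le_one' (he g) (hθ1 g)
  · by_cases hinv : ∃ h ∈ H, U.Invariant (g * h)
    · obtain ⟨h, hh, hd⟩ := hinv
      have hdH : g * h ∉ H := fun h' ↦ hg ((H.mul_mem_cancel_right hh).1 h')
      have hga : g • (e * θ) = (g * h) • (e * θ) := by rw [mul_smul, haH h hh]
      rw [hga]
      set d := g * h
      have h1 : U.valuation (d • θ - θ) = 1 :=
        le_antisymm (U.valuation.map_sub_le (hθ1 d) hvθ.le)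
          (not_lt.1 ((hBs ⟨d, hd, hdH⟩ _).not.1 (hθB (some ⟨d, hd, hdH⟩))))
      have h2 : d • (e * θ) - e * θ =
          (d • θ - θ) + (d • (e - 1) * d • θ - (e - 1) * θ) := by
        rw [smul_mul', smul_sub, smul_one]; ring
      rw [h2, U.valuation.map_add_eq_of_lt_left, h1]
      rw [h1]
      refine U.valuation.map_sub_lt ?_ ?_
      · rw [map_mul, hd, hd, hvθ, mul_one]; exact he1
      · rw [map_mul, hvθ, mul_one]; exact he1
    · push Not at hinv
      have h1 : U.valuation (g • (e * θ)) < 1 := by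
        rw [smul_mul', map_mul]
        exact (mul_le_of_le_one_right' (hθ1 g)).trans_lt (heg g hinv)
      have h2 : U.valuation (e * θ) = 1 := by rw [map_mul, hve, hvθ, one_mul]
      rw [U.valuation.map_sub_eq_of_lt_right (by rw [h2]; exact h1), h2]

end Subgroup

end ValuationSubring

section Dual

variable {W L L' : Type*} [CommRing W] [IsDomain W] [IsIntegrallyClosed W] [Field L] [Field L']
  [Algebra W L] [IsFractionRing W L] [Algebra L L'] [Algebra W L'] [IsScalarTower W L L']
  [FiniteDimensional L L'] [Algebra.IsSeparable L L']

open Polynomial in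
/-- An integral element becomes a polynomial in a primitive element `a` after multiplication by the
different of `a`. -/
lemma IsIntegral.exists_aeval_eq_mul_derivative {a x : L'} (ha : Algebra.adjoin L {a} = ⊤)
    (haW : IsIntegral W a) (hx : IsIntegral W x) :
    ∃ p : W[X], aeval a p = x * aeval a (derivative (minpoly L a)) := by
  have hx' : x ∈ (Algebra.traceForm L L').dualSubmodule
      (Subalgebra.toSubmodule (Algebra.adjoin W {a})) := by
    rw [LinearMap.BilinForm.mem_dualSubmodule]
    intro y hy
    have hy' : IsIntegral W y := by
      have : Algebra.adjoin W {a} ≤ integralClosure W L' :=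
        Algebra.adjoin_le (by simpa [mem_integralClosure_iff] using haW)
      exact this hy
    obtain ⟨c, hc⟩ := IsIntegrallyClosed.algebraMap_eq_of_integral
      (Algebra.isIntegral_trace (L := L) (hx.mul hy'))
    rw [Submodule.mem_one]
    exact ⟨c, hc⟩
  rw [traceForm_dualSubmodule_adjoin W L ha haW] at hx'
  obtain ⟨y, hy, hyx⟩ := hx'
  have hd : aeval a (derivative (minpoly L a)) ≠ 0 :=
    (Algebra.IsSeparable.isSeparable L a).aeval_derivative_ne_zero (minpoly.aeval L a)
  rw [Algebra.adjoin_singleton_eq_range_aeval] at hy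
  obtain ⟨p, rfl⟩ := hy
  refine ⟨p, ?_⟩
  rw [← hyx]
  simp [mul_comm _ (aeval a p), hd]

end Dual

namespace ValuationSubring

section Galois

open Polynomial

variable {L N : Type*} [Field L] [Field N] [Algebra L N] [FiniteDimensional L N] [IsGalois L N]
  {U : ValuationSubring N}

lemma isIntegral_of_forall_mem {x : N} (hx : ∀ g : Gal(N/L), g x ∈ U) :
    ((algebraMap L N).comp (U.comap (algebraMap L N)).subtype).IsIntegralElem x := by
  classical
  set P : N[X] := ∏ g : Gal(N/L), (X - C (g x)) with hP
  have hPU : P ∈ lifts U.subtype := by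
    refine Subsemiring.prod_mem _ fun g _ ↦ ?_
    exact ⟨X - C ⟨g x, hx g⟩, by simp⟩
  have hPg : ∀ g : Gal(N/L), P.map (g : N →+* N) = P := by
    intro g
    rw [hP, Polynomial.map_prod]
    simp only [Polynomial.map_sub, map_X, map_C]
    exact Fintype.prod_equiv (Equiv.mulLeft g) _ _ fun h ↦ rfl
  have hPW : P ∈ lifts ((algebraMap L N).comp (U.comap (algebraMap L N)).subtype) := by
    rw [lifts_iff_coeff_lifts]
    intro n
    have h1 : P.coeff n ∈ (⊥ : IntermediateField L N) := by
      rw [IsGalois.mem_bot_iff_fixed]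
      intro g
      conv_rhs => rw [← hPg g]
      rw [coeff_map]
      rfl
    obtain ⟨c, hc⟩ := IntermediateField.mem_bot.1 h1
    obtain ⟨u, hu⟩ := (lifts_iff_coeff_lifts P).1 hPU n
    refine ⟨⟨c, ?_⟩, hc⟩
    rw [mem_comap, hc, ← hu]
    exact u.2
  have hPm : P.Monic := monic_prod_of_monic _ _ fun g _ ↦ monic_X_sub_C _
  obtain ⟨Q, hQ, -, hQm⟩ := lifts_and_degree_eq_and_monic hPW hPm
  refine ⟨Q, hQm, ?_⟩
  rw [← eval_map, hQ, hP, eval_prod]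
  exact Finset.prod_eq_zero (Finset.mem_univ 1) (by simp)

variable {L' : Type*} [Field L'] [Algebra L L'] [Algebra L' N] [IsScalarTower L L' N]

lemma exists_primitive_of_galois [CharZero L]
    (hU : ∀ n : ℕ, n ≠ 0 → U.valuation (n : N) = 1)
    (hval : ∀ x : L', ∃ c : L, U.valuation (algebraMap L N c) = U.valuation (algebraMap L' N x)) :
    ∃ a : L', Algebra.adjoin L {a} = ⊤ ∧ (∀ g : Gal(N/L), g (algebraMap L' N a) ∈ U) ∧
      U.valuation (algebraMap L' N (aeval a (derivative (minpoly L a)))) = 1 := by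
  classical
  set F : IntermediateField L N := (IsScalarTower.toAlgHom L L' N).fieldRange with hF
  have hFmem (x : N) : x ∈ F ↔ ∃ y, algebraMap L' N y = x := by
    simp [hF]
  set H : Subgroup Gal(N/L) := F.fixingSubgroup with hHdef
  have hfix (x : N) : (∀ h ∈ H, h • x = x) ↔ x ∈ F := by
    rw [← IsGalois.fixedField_fixingSubgroup F, IntermediateField.mem_fixedField_iff]
    rfl
  have hH (g : Gal(N/L)) (hg : ∀ x : N, (∀ h ∈ H, h • x = x) → g • x = x) :
      g ∈ H := by
    rw [hHdef, IntermediateField.mem_fixingSubgroup_iff]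
    exact fun x hx ↦ hg x ((hfix x).2 hx)
  obtain ⟨a', haH, haU, hag⟩ := exists_separated_generator (G := Gal(N/L)) hU hH (by
    intro x hx
    obtain ⟨y, rfl⟩ := (hFmem x).1 ((hfix x).1 hx)
    obtain ⟨c, hc⟩ := hval y
    exact ⟨_, fun g ↦ g.commutes c, hc⟩)
  obtain ⟨a, rfl⟩ := (hFmem a').1 ((hfix a').1 haH)
  have hintegral : IsIntegral L a := by
    rw [← isIntegral_algebraMap_iff (algebraMap L' N).injective]
    exact Algebra.IsIntegral.isIntegral (algebraMap L' N a)
  have hfd : FiniteDimensional L L' :=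
    FiniteDimensional.of_injective (IsScalarTower.toAlgHom L L' N).toLinearMap
      (algebraMap L' N).injective
  refine ⟨a, ?_, fun g ↦ ?_, ?_⟩
  · have hle : F ≤ IntermediateField.adjoin L {algebraMap L' N a} := by
      rw [← IsGalois.fixedField_fixingSubgroup (IntermediateField.adjoin L {algebraMap L' N a})]
      rw [IntermediateField.le_iff_le]
      intro g hg
      by_contra hgH
      have := hag g hgH
      rw [IntermediateField.mem_fixingSubgroup_iff] at hg
      have h0 : g • algebraMap L' N a = algebraMap L' N a :=
        hg _ (IntermediateField.mem_adjoin_simple_self L _)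
      rw [h0, sub_self, map_zero] at this
      exact zero_ne_one this
    rw [← IntermediateField.adjoin_eq_top_iff, _root_.eq_top_iff]
    rintro x -
    have hx := hle ((hFmem _).2 ⟨x, rfl⟩)
    have : IntermediateField.adjoin L {algebraMap L' N a} =
        (IntermediateField.adjoin L {a}).map (IsScalarTower.toAlgHom L L' N) := by
      rw [IntermediateField.adjoin_map]; simp
    rw [this] at hx
    obtain ⟨y, hy, hyx⟩ := hx
    rwa [(algebraMap L' N).injective hyx] at hy
  · exact (U.valuation_le_one_iff _).1 (haU g)
  · set f := minpoly L (algebraMap L' N a) with hf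
    have hff : minpoly L a = f := minpoly.algebraMap_eq (algebraMap L' N).injective a |>.symm
    have hsp : (f.map (algebraMap L N)).Splits :=
      Normal.splits inferInstance (algebraMap L' N a)
    have hm : (f.map (algebraMap L N)).Monic :=
      (minpoly.monic (Algebra.IsIntegral.isIntegral (algebraMap L' N a))).map _
    have hsep : f.Separable := Algebra.IsSeparable.isSeparable L (algebraMap L' N a)
    have hroot : algebraMap L' N a ∈ (f.map (algebraMap L N)).roots := by
      rw [mem_roots hm.ne_zero, IsRoot, eval_map_algebraMap, minpoly.aeval]
    have h1 := hsp.eval_root_derivative hm hroot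
    rw [derivative_map, eval_map_algebraMap] at h1
    rw [hff, ← aeval_algebraMap_apply, h1, map_multiset_prod]
    refine Multiset.prod_eq_one fun v hv ↦ ?_
    simp only [Multiset.mem_map, exists_exists_and_eq_and] at hv
    obtain ⟨r, hr, rfl⟩ := hv
    have hnd : (f.map (algebraMap L N)).roots.Nodup := nodup_roots hsep.map
    rw [hnd.mem_erase_iff, mem_roots hm.ne_zero, IsRoot, eval_map_algebraMap] at hr
    obtain ⟨hra, hr⟩ := hr
    have hconj : IsConjRoot L r (algebraMap L' N a) := by
      refine IsConjRoot.symm ?_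
      exact (minpoly.eq_of_irreducible_of_monic
        (minpoly.irreducible (Algebra.IsIntegral.isIntegral _)) hr
        (minpoly.monic (Algebra.IsIntegral.isIntegral _)))
    obtain ⟨g, rfl⟩ := isConjRoot_iff_exists_algEquiv.1 hconj
    rw [← U.valuation.map_neg, neg_sub]
    exact hag g fun hg ↦ hra (haH g hg)

end Galois

end ValuationSubring

namespace ValuationSubring

section Extension

variable {L N : Type*} [Field L] [Field N]

/-- Chevalley's extension theorem. -/
lemma exists_comap_eq (φ : L →+* N) (O : ValuationSubring L) :
    ∃ U : ValuationSubring N, U.comap φ = O := by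
  obtain ⟨U, hle, hloc⟩ := (O.toLocalSubring.map φ).exists_le_valuationSubring
  have hOU (x : L) (hx : x ∈ O) : φ x ∈ U := hle ⟨x, hx, rfl⟩
  refine ⟨U, SetLike.ext fun x ↦ ⟨fun hx ↦ ?_, hOU x⟩⟩
  rw [mem_comap] at hx
  rcases O.mem_or_inv_mem x with h | h
  · exact h
  rcases eq_or_ne x 0 with rfl | h0
  · exact O.zero_mem
  have hu : IsUnit (Subring.inclusion hle ⟨φ x⁻¹, x⁻¹, h, rfl⟩) :=
    IsUnit.of_mul_eq_one ⟨φ x, hx⟩ (Subtype.ext (by simp [h0]))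
  obtain ⟨⟨_, z, hz, rfl⟩, hy⟩ := isUnit_iff_exists_inv.1 (hloc.1 _ hu)
  have h1 : φ x⁻¹ * φ z = 1 := congrArg Subtype.val hy
  rw [← map_mul, map_eq_one_iff φ φ.injective, inv_mul_eq_one₀ h0] at h1
  rw [h1]
  exact hz

variable (U : ValuationSubring N) (φ : L →+* N)

lemma valuation_comap_le_iff (x y : L) :
    (U.comap φ).valuation x ≤ (U.comap φ).valuation y ↔
      U.valuation (φ x) ≤ U.valuation (φ y) := by
  rcases eq_or_ne y 0 with rfl | hy
  · simp
  · have h1 := (U.comap φ).valuation_le_one_iff (x / y)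
    have h2 := U.valuation_le_one_iff (φ (x / y))
    rw [mem_comap, ← h2, map_div₀, map_div₀, map_div₀, div_le_one₀, div_le_one₀] at h1
    · exact h1
    · rw [Valuation.pos_iff]; simpa
    · rw [Valuation.pos_iff]; simpa

lemma valuation_comap_eq_iff (x y : L) :
    (U.comap φ).valuation x = (U.comap φ).valuation y ↔
      U.valuation (φ x) = U.valuation (φ y) := by
  simp only [le_antisymm_iff, valuation_comap_le_iff]

lemma valuation_comap_eq_one_iff (x : L) :
    (U.comap φ).valuation x = 1 ↔ U.valuation (φ x) = 1 := by
  simpa using U.valuation_comap_eq_iff φ x 1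

end Extension

section Finite

open Polynomial

/-- A finite extension of valued fields of residue characteristic zero with the same value group is
generated by an element whose minimal polynomial is integral and has invertible derivative, and
its valuation ring is a localization of the algebra generated by this element. -/
theorem exists_primitive_of_valuation_eq {L L' : Type*} [Field L] [Field L'] [CharZero L]
    [Algebra L L'] [FiniteDimensional L L'] (O : ValuationSubring L')
    (hO : ∀ n : ℕ, n ≠ 0 → O.valuation (n : L') = 1)
    (hval : ∀ x : L', ∃ c : L, O.valuation (algebraMap L L' c) = O.valuation x) :
    ∃ a ∈ O, (∀ i, algebraMap L L' ((minpoly L a).coeff i) ∈ O) ∧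
      O.valuation (aeval a (derivative (minpoly L a))) = 1 ∧
      ∀ w ∈ O, ∃ P Q : L[X], (∀ i, algebraMap L L' (P.coeff i) ∈ O) ∧
        (∀ i, algebraMap L L' (Q.coeff i) ∈ O) ∧ O.valuation (aeval a Q) = 1 ∧
        aeval a P = w * aeval a Q := by
  let N := IntermediateField.normalClosure L L' (AlgebraicClosure L')
  have : IsScalarTower L L' N := inferInstance
  have : FiniteDimensional L N := inferInstance
  have : IsGalois L N := ⟨⟩
  obtain ⟨U, rfl⟩ := exists_comap_eq (algebraMap L' N) O
  have hU (n : ℕ) (hn : n ≠ 0) : U.valuation (n : N) = 1 := by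
    have := hO n hn
    rwa [valuation_comap_eq_one_iff, map_natCast] at this
  obtain ⟨a, hgen, haU, hder⟩ := exists_primitive_of_galois (L := L) (L' := L') hU fun x ↦ by
    obtain ⟨c, hc⟩ := hval x
    rw [valuation_comap_eq_iff, ← IsScalarTower.algebraMap_apply] at hc
    exact ⟨c, hc⟩
  let W := U.comap (algebraMap L N)
  let _ : Algebra W L' := ((algebraMap L L').comp W.subtype).toAlgebra
  have : IsScalarTower W L L' := .of_algebraMap_eq fun _ ↦ rfl
  let _ : Algebra W N := ((algebraMap L N).comp W.subtype).toAlgebra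
  have : IsScalarTower W L' N := .of_algebraMap_eq fun x ↦
    IsScalarTower.algebraMap_apply L L' N (x : L)
  have hintegral (x : L') (hx : ∀ g : Gal(N/L), g (algebraMap L' N x) ∈ U) : IsIntegral W x := by
    rw [← isIntegral_algebraMap_iff (algebraMap L' N).injective]
    exact isIntegral_of_forall_mem hx
  have haW := hintegral a haU
  have hcoeff (p : W[X]) (i : ℕ) : algebraMap L L' ((p.map (algebraMap W L)).coeff i) ∈
      U.comap (algebraMap L' N) := by
    rw [coeff_map, mem_comap, ← IsScalarTower.algebraMap_apply]
    exact (p.coeff i).2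
  have hmem (x : L') (hx : IsIntegral W x) : ∃ p : L[X], (∀ i, algebraMap L L' (p.coeff i) ∈
      U.comap (algebraMap L' N)) ∧ aeval a p = x * aeval a (derivative (minpoly L a)) := by
    obtain ⟨p, hp⟩ := IsIntegral.exists_aeval_eq_mul_derivative (W := W) hgen haW hx
    exact ⟨p.map (algebraMap W L), hcoeff p, by rw [aeval_map_algebraMap, hp]⟩
  refine ⟨a, haU 1, fun i ↦ ?_, by rwa [valuation_comap_eq_one_iff], fun w hw ↦ ?_⟩
  · rw [minpoly.isIntegrallyClosed_eq_field_fractions' L haW]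
    exact hcoeff _ i
  · rw [mem_comap] at hw
    obtain ⟨t', ht, htw, ht1, htfix⟩ := exists_mul_valuation_smul_le_one Gal(N/L) hU
      ((U.valuation_le_one_iff _).2 hw)
    obtain ⟨t, rfl⟩ : ∃ t, algebraMap L' N t = t' := by
      set F : IntermediateField L N := (IsScalarTower.toAlgHom L L' N).fieldRange with hF
      have : t' ∈ F := by
        rw [← IsGalois.fixedField_fixingSubgroup F, IntermediateField.mem_fixedField_iff]
        intro h hh
        rw [IntermediateField.mem_fixingSubgroup_iff] at hh
        exact htfix h (hh _ ⟨w, rfl⟩)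
      exact this
    obtain ⟨Q, hQ, hQa⟩ := hmem t (hintegral t fun g ↦ (U.valuation_le_one_iff _).1 (ht g))
    obtain ⟨P, hP, hPa⟩ := hmem (t * w) (hintegral _ fun g ↦ (U.valuation_le_one_iff _).1 (by
      rw [map_mul]; exact htw g))
    refine ⟨P, Q, hP, hQ, ?_, by rw [hPa, hQa]; ring⟩
    rw [valuation_comap_eq_one_iff, hQa, map_mul, map_mul, ht1, hder, one_mul]

end Finite

end ValuationSubring

section Transcendental

variable {V V' : Type*} [CommRing V] [IsDomain V] [ValuationRing V] [CommRing V'] [IsDomain V']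
  [ValuationRing V'] [Algebra V V'] [IsLocalHom (algebraMap V V')] {ι : Type*} {y : ι → V'}

open MvPolynomial IsLocalRing

/-- Every nonzero polynomial over a valuation ring is the product of its content and of a polynomial
with a coefficient equal to `1`. -/
lemma MvPolynomial.exists_eq_C_mul_of_valuationRing {p : MvPolynomial ι V} (hp : p ≠ 0) :
    ∃ c ≠ 0, ∃ q m, p = C c * q ∧ q.coeff m = 1 := by
  classical
  obtain ⟨m, hm, hmax⟩ := Finset.exists_max_image p.support (fun m ↦ Ideal.span {p.coeff m})
    (support_nonempty.2 hp)
  have hdvd : C (p.coeff m) ∣ p := by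
    rw [C_dvd_iff_dvd_coeff]
    intro i
    by_cases hi : i ∈ p.support
    · exact Ideal.span_singleton_le_span_singleton.1 (hmax i hi)
    · rw [notMem_support_iff.1 hi]; exact dvd_zero _
  obtain ⟨q, hq⟩ := hdvd
  have hc : p.coeff m ≠ 0 := mem_support_iff.1 hm
  refine ⟨_, hc, q, m, hq, mul_left_cancel₀ hc ?_⟩
  rw [← coeff_C_mul, ← hq, mul_one]

lemma isUnit_aeval_of_coeff_eq_one
    (hy : ∀ p : MvPolynomial ι (ResidueField V),
      p.eval₂ (ResidueField.map (algebraMap V V')) (fun i ↦ residue V' (y i)) = 0 → p = 0)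
    {q : MvPolynomial ι V} {m} (hq : q.coeff m = 1) : IsUnit (aeval y q) := by
  rw [← residue_ne_zero_iff_isUnit]
  intro h
  have h1 : q.map (residue V) = 0 := by
    apply hy
    rw [eval₂_map, ← h, aeval_def, ← coe_eval₂Hom (algebraMap V V') y, ← RingHom.comp_apply,
      comp_eval₂Hom]
    rfl
  have h2 := coeff_map (residue V) q m
  rw [h1, hq, map_one, coeff_zero] at h2
  exact zero_ne_one h2

variable {K K' : Type*} [Field K] [Field K'] [Algebra V K] [IsFractionRing V K] [Algebra V' K']
  [IsFractionRing V' K'] [Algebra K K'] [Algebra V K'] [IsScalarTower V K K']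
  [IsScalarTower V V' K']

lemma algebraicIndependent_of_residue (hinj : Function.Injective (algebraMap V V'))
    (hy : ∀ p : MvPolynomial ι (ResidueField V),
      p.eval₂ (ResidueField.map (algebraMap V V')) (fun i ↦ residue V' (y i)) = 0 → p = 0) :
    AlgebraicIndependent V y := by
  rw [algebraicIndependent_iff]
  intro p hp
  by_contra hp0
  obtain ⟨c, hc, q, m, rfl, hq⟩ := exists_eq_C_mul_of_valuationRing hp0
  rw [map_mul, aeval_C, (isUnit_aeval_of_coeff_eq_one hy hq).mul_left_eq_zero] at hp
  exact hc (hinj (by rw [hp, map_zero]))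

omit [ValuationRing V] in
variable (K) in
/-- Every polynomial over the fraction field becomes integral after multiplication by a nonzero
constant. -/
lemma MvPolynomial.exists_map_eq_C_mul_s5 (p : MvPolynomial ι K) :
    ∃ c : V, c ≠ 0 ∧ ∃ q : MvPolynomial ι V, q.map (algebraMap V K) = C (algebraMap V K c) * p := by
  let := algebraMvPolynomial (σ := ι) (R := V) (S := K)
  obtain ⟨⟨q, ⟨_, c, hc, rfl⟩⟩, hq⟩ := IsLocalization.surj ((nonZeroDivisors V).map (C (σ := ι))) p
  refine ⟨c, nonZeroDivisors.ne_zero hc, q, ?_⟩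
  rw [algebraMap_def] at hq
  rw [← hq, mul_comm]
  simp

omit [IsDomain V] [ValuationRing V] [IsFractionRing V K] [IsFractionRing V' K'] [IsDomain V']
  [ValuationRing V'] [IsLocalHom (algebraMap V V')] in
lemma algebraMap_aeval_eq_aeval_map (q : MvPolynomial ι V) :
    aeval (fun i ↦ algebraMap V' K' (y i)) (q.map (algebraMap V K)) =
      algebraMap V' K' (aeval y q) := by
  rw [aeval_map_algebraMap, ← aeval_algebraMap_apply]
  rfl

variable (K K') in
omit [ValuationRing V] [IsLocalHom (algebraMap V V')] [IsDomain V'] [ValuationRing V'] in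
lemma AlgebraicIndependent.algebraMap_fractionRing (hy : AlgebraicIndependent V y) :
    AlgebraicIndependent K (fun i ↦ algebraMap V' K' (y i)) := by
  rw [algebraicIndependent_iff]
  intro p hp
  obtain ⟨c, hc, q, hq⟩ := exists_map_eq_C_mul_s5 (V := V) K p
  have h1 : q = 0 := by
    refine algebraicIndependent_iff.1 hy _ ?_
    apply IsFractionRing.injective V' K'
    rw [← algebraMap_aeval_eq_aeval_map (K := K), hq, map_mul, hp, mul_zero, map_zero]
  rw [h1, map_zero, zero_eq_mul] at hq
  refine hq.resolve_left ?_
  simpa using hc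

/-- The elements of `K(y) ∩ V'` are fractions of polynomials in `y` over `V` whose denominator is
invertible in `V'`. -/
lemma exists_aeval_mul_eq_of_mem_adjoin (hinj : Function.Injective (algebraMap V V'))
    (hy : ∀ p : MvPolynomial ι (ResidueField V),
      p.eval₂ (ResidueField.map (algebraMap V V')) (fun i ↦ residue V' (y i)) = 0 → p = 0)
    {x : V'} (hx : algebraMap V' K' x ∈
      IntermediateField.adjoin K (Set.range fun i ↦ algebraMap V' K' (y i))) :
    ∃ p q : MvPolynomial ι V, IsUnit (aeval y q) ∧ x * aeval y q = aeval y p := by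
  obtain ⟨p', q', hpq⟩ := (IntermediateField.mem_adjoin_range_iff ..).1 hx
  by_cases hx0 : x = 0
  · exact ⟨0, 1, by simp, by simp [hx0]⟩
  have hind := algebraicIndependent_of_residue hinj hy
  have hx0' : algebraMap V' K' x ≠ 0 := by simpa using hx0
  rw [hpq, div_ne_zero_iff] at hx0'
  obtain ⟨c, hc, p, hp⟩ := exists_map_eq_C_mul_s5 (V := V) K p'
  obtain ⟨d, hd, q, hq⟩ := exists_map_eq_C_mul_s5 (V := V) K q'
  have hpy : algebraMap V' K' (aeval y p) =
      algebraMap V K' c * aeval (fun i ↦ algebraMap V' K' (y i)) p' := by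
    rw [← algebraMap_aeval_eq_aeval_map (K := K), hp, map_mul, aeval_C,
      ← IsScalarTower.algebraMap_apply]
  have hqy : algebraMap V' K' (aeval y q) =
      algebraMap V K' d * aeval (fun i ↦ algebraMap V' K' (y i)) q' := by
    rw [← algebraMap_aeval_eq_aeval_map (K := K), hq, map_mul, aeval_C,
      ← IsScalarTower.algebraMap_apply]
  have key : x * aeval y (C c * q) = aeval y (C d * p) := by
    apply IsFractionRing.injective V' K'
    simp only [map_mul, aeval_C, hpy, hqy, ← IsScalarTower.algebraMap_apply]
    rw [hpq]
    field_simp [hx0'.2]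
  have hne (b : V) (hb : b ≠ 0) : algebraMap V K' b ≠ 0 := by
    rw [IsScalarTower.algebraMap_apply V V' K']
    simpa using fun h ↦ hb (hinj (by rw [h, map_zero]))
  have hp0 : C d * p ≠ 0 := by
    refine mul_ne_zero (by simpa using hd) ?_
    rintro rfl
    rw [map_zero, map_zero, zero_eq_mul] at hpy
    exact hpy.elim (hne c hc) hx0'.1
  have hq0 : C c * q ≠ 0 := by
    refine mul_ne_zero (by simpa using hc) ?_
    rintro rfl
    rw [map_zero, map_zero, zero_eq_mul] at hqy
    exact hqy.elim (hne d hd) hx0'.2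
  generalize C d * p = P at key hp0
  generalize C c * q = Q at key hq0
  obtain ⟨b, hb, P, m, rfl, hP⟩ := exists_eq_C_mul_of_valuationRing hp0
  obtain ⟨e, he, Q, m', rfl, hQ⟩ := exists_eq_C_mul_of_valuationRing hq0
  have hPu := isUnit_aeval_of_coeff_eq_one hy hP
  have hQu := isUnit_aeval_of_coeff_eq_one hy hQ
  have hV' (z : V) (hz : z ≠ 0) : algebraMap V V' z ≠ 0 :=
    fun h ↦ hz (hinj (by rw [h, map_zero]))
  simp only [map_mul, aeval_C] at key
  obtain ⟨r, rfl⟩ : e ∣ b := by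
    rcases ValuationRing.dvd_total e b with h | ⟨r, rfl⟩
    · exact h
    · rw [map_mul, mul_left_comm, mul_assoc] at key
      have key' := mul_left_cancel₀ (hV' b hb) key
      have hr : IsUnit (algebraMap V V' r) := by
        refine isUnit_of_mul_isUnit_left (y := x * aeval y Q) ?_
        rw [key']
        exact hPu
      have hr' : IsUnit r := isUnit_of_map_unit (algebraMap V V') r hr
      exact hr'.mul_right_dvd.2 dvd_rfl
  refine ⟨C r * P, Q, hQu, ?_⟩
  rw [map_mul, mul_left_comm, mul_assoc] at key
  rw [map_mul, aeval_C]
  exact mul_left_cancel₀ (hV' e he) key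

end Transcendental

section StandardEtale

open Polynomial

variable {R B : Type*} [CommRing R] [CommRing B] [Algebra R B]

namespace StandardEtalePair

variable (P : StandardEtalePair R) {x : B} (hx : P.HasMap x)

lemma exists_mul_aeval_X_pow_eq (z : P.Ring) :
    ∃ p : R[X], ∃ n, z * aeval P.X P.g ^ n = aeval P.X p :=
  StandardEtalePresentation.exists_mul_aeval_x_g_pow_eq_aeval_x
    (P := ⟨P, P.X, P.hasMap_X, by simpa [lift_X_left] using Function.bijective_id⟩) z

include hx in
lemma lift_injective (hker : ∀ p : R[X], aeval x p = 0 → P.f ∣ p) :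
    Function.Injective (P.lift x hx) := by
  rw [injective_iff_map_eq_zero]
  intro z hz
  obtain ⟨p, n, hp⟩ := P.exists_mul_aeval_X_pow_eq z
  have h1 := congrArg (P.lift x hx) hp
  rw [map_mul, hz, zero_mul, ← aeval_algHom_apply, lift_X] at h1
  have h2 : aeval P.X p = 0 := by
    obtain ⟨q, rfl⟩ := hker p h1.symm
    rw [map_mul, P.hasMap_X.1, zero_mul]
  rw [h2] at hp
  exact ((P.hasMap_X.2.pow n).mul_left_eq_zero).1 hp

lemma mem_range_lift {u : B} {p q : R[X]} (hq : q ∣ P.g) (hu : u * aeval x q = aeval x p) :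
    u ∈ (P.lift x hx).range := by
  have h1 : IsUnit (aeval P.X q) :=
    isUnit_of_dvd_unit (map_dvd (aeval P.X) hq) P.hasMap_X.2
  obtain ⟨v, hv⟩ := h1.exists_left_inv
  have hv' := congrArg (P.lift x hx) hv
  rw [map_mul, ← aeval_algHom_apply, lift_X, map_one] at hv'
  refine ⟨aeval P.X p * v, ?_⟩
  change P.lift x hx _ = u
  rw [map_mul, ← aeval_algHom_apply, lift_X, ← hu, mul_assoc, mul_comm _ (P.lift x hx v), hv',
    mul_one]

end StandardEtalePair

/-- If finitely many elements of `B` are fractions of polynomials in `x`, and `x` is a simple root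
of a monic polynomial generating the relations of `x`, then they lie in a standard étale subalgebra
of `B`. -/
lemma exists_etale_of_fractions {R : Type u} {B : Type v} [CommRing R] [CommRing B] [Algebra R B]
    {x : B} {f : R[X]} (hf : f.Monic) (hfx : aeval x f = 0) (hf' : IsUnit (aeval x (derivative f)))
    (hker : ∀ p : R[X], aeval x p = 0 → f ∣ p) (s : Finset B)
    (hs : ∀ u ∈ s, ∃ p q : R[X], IsUnit (aeval x q) ∧ u * aeval x q = aeval x p) :
    ∃ (S : Type u) (_ : CommRing S) (_ : Algebra R S), Algebra.Etale R S ∧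
      ∃ h : S →ₐ[R] B, Function.Injective h ∧ ∀ u ∈ s, u ∈ h.range := by
  choose! p q hq hu using hs
  let P : StandardEtalePair R :=
    ⟨f, hf, derivative f * ∏ u ∈ s, q u, ∏ u ∈ s, q u, 0, 1, by simp⟩
  have hx : P.HasMap x := by
    refine ⟨hfx, ?_⟩
    rw [map_mul, map_prod]
    refine hf'.mul ?_
    rw [IsUnit.prod_iff]
    exact hq
  exact ⟨P.Ring, inferInstance, inferInstance, inferInstance, P.lift x hx,
    P.lift_injective hx hker, fun u hus ↦
      P.mem_range_lift hx ((Finset.dvd_prod_of_mem q hus).mul_left _) (hu u hus)⟩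

end StandardEtale

section Factor

/-- An algebra homomorphism whose range is contained in the range of an injective homomorphism from
a smooth algebra factors through this smooth algebra. -/
lemma exists_factor_of_range_le {A E S B : Type*} [CommRing A] [CommRing E] [CommRing S]
    [CommRing B] [Algebra A E] [Algebra A S] [Algebra A B] (w : E →ₐ[A] B) (h : S →ₐ[A] B)
    (hh : Function.Injective h) (s : Set E) (hs : Algebra.adjoin A s = ⊤)
    (hw : ∀ e ∈ s, w e ∈ h.range) : ∃ g : E →ₐ[A] S, h.comp g = w := by
  have hrange (e : E) : w e ∈ h.range := by
    have h1 : (Algebra.adjoin A s).map w ≤ h.range := by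
      rw [AlgHom.map_adjoin, Algebra.adjoin_le_iff]
      rintro _ ⟨e, he, rfl⟩
      exact hw e he
    exact h1 ⟨e, by rw [hs]; trivial, rfl⟩
  let g : E →ₐ[A] S :=
    ((AlgEquiv.ofInjective h hh).symm : h.range →ₐ[A] S).comp (w.codRestrict h.range hrange)
  refine ⟨g, AlgHom.ext fun e ↦ ?_⟩
  have := (AlgEquiv.ofInjective h hh).apply_symm_apply ⟨w e, hrange e⟩
  exact congrArg Subtype.val this

end Factor

section Descent

open IsLocalRing

variable {V : Type u} {V' : Type v} [CommRing V] [IsDomain V] [ValuationRing V] [CommRing V']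
  [IsDomain V'] [ValuationRing V'] [Algebra V V'] [IsLocalHom (algebraMap V V')] {ι : Type}
  {y : ι → V'}

omit [IsDomain V] [ValuationRing V] [IsDomain V'] [ValuationRing V']
  [IsLocalHom (algebraMap V V')] in
lemma MvPolynomial.exists_common_denominator {κ : Type*} (T : Finset κ) (c : κ → V')
    (hT : ∀ i ∈ T, ∃ p q : MvPolynomial ι V, IsUnit (aeval y q) ∧ c i * aeval y q = aeval y p) :
    ∃ q : MvPolynomial ι V, IsUnit (aeval y q) ∧ ∀ i ∈ T, ∃ p : MvPolynomial ι V,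
      c i * aeval y q = aeval y p := by
  choose! p q hq hpq using hT
  refine ⟨∏ i ∈ T, q i, ?_, fun i hi ↦ ?_⟩
  · rw [map_prod, IsUnit.prod_iff]
    exact hq
  · obtain ⟨r, hr⟩ := Finset.dvd_prod_of_mem q hi
    exact ⟨p i * r, by rw [hr, map_mul, map_mul, ← mul_assoc, hpq i hi]⟩

variable {K : Type*} {K' : Type*} [Field K] [Field K'] [Algebra V' K'] [IsFractionRing V' K']
  [Algebra V K'] [IsScalarTower V V' K'] [Algebra V K] [Algebra K K'] [IsScalarTower V K K']
  [IsFractionRing V K]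

/-- Finitely many elements of `K(y) ∩ V'` lie in a smooth `V`-subalgebra of `V'`. -/
lemma exists_smooth_of_mem_adjoin [Finite ι] (hinj : Function.Injective (algebraMap V V'))
    (hy : ∀ p : MvPolynomial ι (ResidueField V),
      p.eval₂ (ResidueField.map (algebraMap V V')) (fun i ↦ residue V' (y i)) = 0 → p = 0)
    {L : IntermediateField K K'}
    (hL : L = IntermediateField.adjoin K (Set.range fun i ↦ algebraMap V' K' (y i)))
    (T : Finset L) (hT : ∀ c ∈ T, (c : K') ∈ (algebraMap V' K').range) :
    ∃ (R : Type u) (_ : CommRing R) (_ : Algebra V R), Algebra.Smooth V R ∧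
      ∃ (φ : R →ₐ[V] V') (ψ : R →+* L), Function.Injective ψ ∧
        (∀ r, algebraMap V' K' (φ r) = ψ r) ∧ ∀ c ∈ T, c ∈ ψ.range := by
  choose! c hc using hT
  obtain ⟨q, hq, hqT⟩ := MvPolynomial.exists_common_denominator (V := V) (y := y) T c fun i hi ↦
    exists_aeval_mul_eq_of_mem_adjoin (K := K) (K' := K') hinj hy (by
      rw [hc i hi, ← hL]; exact i.2)
  have hyL (i : ι) : algebraMap V' K' (y i) ∈ L := by
    rw [hL]; exact IntermediateField.subset_adjoin _ _ ⟨i, rfl⟩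
  let yL : ι → L := fun i ↦ ⟨_, hyL i⟩
  let ψ₀ : MvPolynomial ι V →+* L :=
    MvPolynomial.eval₂Hom ((algebraMap K L).comp (algebraMap V K)) yL
  have hψ₀ (p : MvPolynomial ι V) : (ψ₀ p : K') = algebraMap V' K' (MvPolynomial.aeval y p) := by
    change ((algebraMap L K').comp ψ₀) p =
      ((algebraMap V' K').comp (MvPolynomial.aeval y).toRingHom) p
    congr 1
    ext v
    · simp only [ψ₀, RingHom.comp_apply, MvPolynomial.coe_eval₂Hom, MvPolynomial.eval₂_C,
        AlgHom.toRingHom_eq_coe, RingHom.coe_coe, MvPolynomial.algHom_C]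
      rw [← IsScalarTower.algebraMap_apply V V' K', IsScalarTower.algebraMap_apply V K K']
      rfl
    · simp [ψ₀, yL]
  have hind := algebraicIndependent_of_residue hinj hy
  have hψ₀inj : Function.Injective ψ₀ := by
    rw [injective_iff_map_eq_zero]
    intro p hp
    refine algebraicIndependent_iff.1 hind p (IsFractionRing.injective V' K' ?_)
    rw [← hψ₀, hp, map_zero, ZeroMemClass.coe_zero]
  have hq0 : q ≠ 0 := by
    rintro rfl
    rw [map_zero] at hq
    exact not_isUnit_zero hq
  have hψq : IsUnit (ψ₀ q) := by
    rw [isUnit_iff_ne_zero, map_ne_zero_iff _ hψ₀inj]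
    exact hq0
  let R := Localization.Away q
  let ψ : R →+* L := IsLocalization.Away.lift q hψq
  let φ₀ : R →+* V' := IsLocalization.Away.lift q (g := (MvPolynomial.aeval y).toRingHom) hq
  let φ : R →ₐ[V] V' := { φ₀ with
    commutes' := fun v ↦ by
      change φ₀ _ = _
      rw [IsScalarTower.algebraMap_apply V (MvPolynomial ι V) R]
      simp [φ₀] }
  have : Algebra.Smooth V (MvPolynomial ι V) := ⟨inferInstance, inferInstance⟩
  have : Algebra.Smooth (MvPolynomial ι V) R := .of_isLocalization_Away q
  refine ⟨R, inferInstance, inferInstance, .comp V (MvPolynomial ι V) R, φ, ψ, ?_, ?_, ?_⟩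
  · rw [injective_iff_map_eq_zero]
    intro r hr
    obtain ⟨⟨p, s⟩, hps⟩ := IsLocalization.surj (Submonoid.powers q) r
    have h1 := congrArg ψ hps
    rw [map_mul, hr, zero_mul] at h1
    simp only [ψ, IsLocalization.Away.lift_eq] at h1
    rw [(map_eq_zero_iff ψ₀ hψ₀inj).1 h1.symm, map_zero] at hps
    exact ((IsLocalization.map_units R s).mul_left_eq_zero).1 hps
  · intro r
    change ((algebraMap V' K').comp φ₀) r = ((algebraMap L K').comp ψ) r
    congr 1
    refine IsLocalization.ringHom_ext (Submonoid.powers q) (RingHom.ext fun p ↦ ?_)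
    simp only [RingHom.comp_apply, φ₀, ψ, IsLocalization.Away.lift_eq]
    exact (hψ₀ p).symm
  · intro i hi
    obtain ⟨p, hp⟩ := hqT i hi
    refine ⟨IsLocalization.mk' R p (⟨q, 1, pow_one q⟩ : Submonoid.powers q), ?_⟩
    have h1 := congrArg ψ (IsLocalization.mk'_spec R p (⟨q, 1, pow_one q⟩ : Submonoid.powers q))
    rw [map_mul] at h1
    simp only [ψ, IsLocalization.Away.lift_eq] at h1
    have h2 : i * ψ₀ q = ψ₀ p := by
      apply Subtype.ext
      rw [MulMemClass.coe_mul, hψ₀, hψ₀, ← hc i hi, ← map_mul, hp]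
    rw [← h2] at h1
    exact mul_right_cancel₀ hψq.ne_zero h1

open Polynomial

/-- Finitely many elements of `V'` which are fractions of integral polynomials in a simple integral
primitive element over `K(y)` lie in a smooth `V`-subalgebra of `V'`. -/
lemma exists_smooth_of_fractions [Finite ι] (hinj : Function.Injective (algebraMap V V'))
    (hy : ∀ p : MvPolynomial ι (ResidueField V),
      p.eval₂ (ResidueField.map (algebraMap V V')) (fun i ↦ residue V' (y i)) = 0 → p = 0)
    {L : IntermediateField K K'}
    (hL : L = IntermediateField.adjoin K (Set.range fun i ↦ algebraMap V' K' (y i)))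
    {a : V'} (ha : IsIntegral L (algebraMap V' K' a))
    (hmin : ∀ i, algebraMap L K' ((minpoly L (algebraMap V' K' a)).coeff i) ∈
      (algebraMap V' K').range)
    (hder : ∃ d, IsUnit d ∧ algebraMap V' K' d =
      aeval (algebraMap V' K' a) (derivative (minpoly L (algebraMap V' K' a))))
    (s : Finset V') (hs : ∀ u ∈ s, ∃ P Q : L[X],
      (∀ i, algebraMap L K' (P.coeff i) ∈ (algebraMap V' K').range) ∧
      (∀ i, algebraMap L K' (Q.coeff i) ∈ (algebraMap V' K').range) ∧
      (∃ d, IsUnit d ∧ algebraMap V' K' d = aeval (algebraMap V' K' a) Q) ∧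
      aeval (algebraMap V' K' a) P = algebraMap V' K' u * aeval (algebraMap V' K' a) Q) :
    ∃ (S : Type u) (_ : CommRing S) (_ : Algebra V S), Algebra.Smooth V S ∧
      ∃ h : S →ₐ[V] V', Function.Injective h ∧ ∀ u ∈ s, u ∈ h.range := by
  classical
  choose! P Q hP hQ hQu hPQ using hs
  set f := minpoly L (algebraMap V' K' a) with hf
  let T : Finset L := f.coeffs ∪ s.biUnion fun u ↦ (P u).coeffs ∪ (Q u).coeffs
  obtain ⟨R, _, _, hR, φ, ψ, hψ, hφψ, hT⟩ := exists_smooth_of_mem_adjoin hinj hy hL T (by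
    simp only [T, Finset.mem_union, Finset.mem_biUnion]
    rintro c (hc | ⟨u, hu, hc | hc⟩)
    all_goals
      obtain ⟨n, -, rfl⟩ := mem_coeffs_iff.1 hc
    · exact hmin n
    · exact hP u hu n
    · exact hQ u hu n)
  have hlift (p : L[X]) (hp : p.coeffs ⊆ T) : p ∈ lifts ψ := by
    rw [lifts_iff_coeff_lifts]
    intro n
    by_cases hn : p.coeff n = 0
    · exact ⟨0, by rw [hn, map_zero]⟩
    · exact hT _ (hp (coeff_mem_coeffs hn))
  obtain ⟨F, hF, -, hFm⟩ := lifts_and_degree_eq_and_monic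
    (hlift f Finset.subset_union_left) (minpoly.monic ha)
  let _ : Algebra R V' := φ.toRingHom.toAlgebra
  let _ : Algebra R L := ψ.toAlgebra
  let _ : Algebra R K' := ((algebraMap L K').comp ψ).toAlgebra
  have : IsScalarTower R L K' := .of_algebraMap_eq fun _ ↦ rfl
  have : IsScalarTower R V' K' := .of_algebraMap_eq fun r ↦ (hφψ r).symm
  have : IsScalarTower V R V' := .of_algebraMap_eq fun r ↦ (φ.commutes r).symm
  have haeval (p : R[X]) : algebraMap V' K' (aeval a p) =
      aeval (algebraMap V' K' a) (p.map ψ) := by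
    rw [← aeval_algebraMap_apply]
    exact (aeval_map_algebraMap L _ p).symm
  have hunit {p : R[X]} (hp : ∃ d, IsUnit d ∧ algebraMap V' K' d =
      aeval (algebraMap V' K' a) (p.map ψ)) : IsUnit (aeval a p) := by
    obtain ⟨d, hd, hdp⟩ := hp
    rw [← haeval] at hdp
    rwa [← IsFractionRing.injective V' K' hdp]
  obtain ⟨S, _, _, hS, h, hh, hsh⟩ := exists_etale_of_fractions (x := a) hFm
    (IsFractionRing.injective V' K' (by rw [haeval, hF, hf, minpoly.aeval, map_zero]))
    (hunit (by rwa [← derivative_map, hF]))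
    (fun p hp ↦ by
      refine (map_dvd_map ψ hψ hFm).1 ?_
      rw [hF]
      refine minpoly.dvd L _ ?_
      rw [← haeval, hp, map_zero]) s
    (fun u hu ↦ by
      have hsub : (P u).coeffs ∪ (Q u).coeffs ⊆ T :=
        (Finset.subset_biUnion_of_mem (fun u ↦ (P u).coeffs ∪ (Q u).coeffs) hu).trans
          Finset.subset_union_right
      obtain ⟨p, hp⟩ := hlift (P u) (Finset.subset_union_left.trans hsub)
      obtain ⟨q, hq⟩ := hlift (Q u) (Finset.subset_union_right.trans hsub)
      rw [coe_mapRingHom] at hp hq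
      refine ⟨p, q, hunit (by rw [hq]; exact hQu u hu), IsFractionRing.injective V' K' ?_⟩
      rw [map_mul, haeval, haeval, hp, hq, hPQ u hu])
  let _ : Algebra V S := ((algebraMap R S).comp (algebraMap V R)).toAlgebra
  have : IsScalarTower V R S := .of_algebraMap_eq fun _ ↦ rfl
  exact ⟨S, inferInstance, inferInstance, .comp V R S, h.restrictScalars V, hh, hsh⟩

end Descent

section Valuation

variable {R F : Type*} [CommRing R] [IsDomain R] [ValuationRing R] [Field F] [Algebra R F]
  [IsFractionRing R F]

/-- A valuation ring, as a valuation subring of its field of fractions. -/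
lemma ValuationSubring.exists_mem_iff_mem_range_algebraMap :
    ∃ O : ValuationSubring F, ∀ x, x ∈ O ↔ x ∈ (algebraMap R F).range :=
  ⟨(ValuationRing.valuation R F).valuationSubring, fun x ↦
    ValuationRing.mem_integer_iff R F x⟩

omit [IsDomain R] [ValuationRing R] in
lemma ValuationSubring.valuation_algebraMap_eq_one_iff {O : ValuationSubring F}
    (hO : ∀ x, x ∈ O ↔ x ∈ (algebraMap R F).range) (d : R) :
    O.valuation (algebraMap R F d) = 1 ↔ IsUnit d := by
  have h1 (x : R) : O.valuation (algebraMap R F x) ≤ 1 := by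
    rw [valuation_le_one_iff, hO]; exact ⟨x, rfl⟩
  refine ⟨fun h ↦ ?_, fun ⟨u, hu⟩ ↦ ?_⟩
  · have h2 : (algebraMap R F d)⁻¹ ∈ O := by
      rw [← valuation_le_one_iff, map_inv₀, h, inv_one]
    obtain ⟨e, he⟩ := (hO _).1 h2
    have h0 : algebraMap R F d ≠ 0 := by
      rintro h0
      rw [h0, map_zero] at h
      exact zero_ne_one h
    refine IsUnit.of_mul_eq_one e (IsFractionRing.injective R F ?_)
    rw [map_mul, he, mul_inv_cancel₀ h0, map_one]
  · refine le_antisymm (h1 d) ?_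
    have h2 : O.valuation (algebraMap R F d) * O.valuation (algebraMap R F ↑u⁻¹) = 1 := by
      rw [← map_mul, ← map_mul, ← hu, Units.mul_inv, map_one, map_one]
    rw [← h2]
    exact mul_le_of_le_one_right' (h1 _)

end Valuation

/-- A finitely generated algebraic field extension is finite over any intermediate field over which
it is algebraic. -/
lemma IntermediateField.finiteDimensional_of_fg_of_isAlgebraic {K K' : Type*} [Field K] [Field K']
    [Algebra K K'] (hFT : (⊤ : IntermediateField K K').FG) (L : IntermediateField K K')
    [Algebra.IsAlgebraic L K'] : FiniteDimensional L K' := by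
  obtain ⟨s, hs⟩ := hFT
  have h1 : IntermediateField.adjoin L (s : Set K') = ⊤ := by
    rw [← IntermediateField.restrictScalars_inj K, IntermediateField.restrictScalars_top,
      _root_.eq_top_iff, ← hs, IntermediateField.adjoin_le_iff]
    exact IntermediateField.subset_adjoin L _
  have h2 := IntermediateField.finiteDimensional_adjoin (K := L) (S := (s : Set K'))
    fun x _ ↦ Algebra.IsIntegral.isIntegral x
  rw [h1] at h2
  exact IntermediateField.topEquiv.toLinearEquiv.finiteDimensional

/-- A transcendence basis of an extension of finite transcendence degree, as a finite family. -/
lemma exists_algebraicIndependent_fin {k k' : Type*} [Field k] [Field k'] [Algebra k k']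
    (hfin : trdegC k k' < Cardinal.aleph0) :
    ∃ (n : ℕ) (x : Fin n → k'), trdegC k k' = n ∧ AlgebraicIndependent k x := by
  obtain ⟨s, hs⟩ := exists_isTranscendenceBasis k k'
  have h1 : Cardinal.mk s = trdegC k k' := hs.cardinalMk_eq_trdeg
  obtain ⟨n, hn⟩ := Cardinal.lt_aleph0.1 hfin
  obtain ⟨e⟩ := Cardinal.mk_eq_nat_iff.1 (h1.trans hn)
  exact ⟨n, fun i ↦ (e.symm i : k'), hn, hs.1.comp e.symm e.symm.injective⟩

open IsLocalRing in
/-- A residual transcendence basis of finite cardinality can be lifted. -/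
lemma exists_lift_transcendenceBasis {V V' : Type*} [CommRing V] [IsLocalRing V] [CommRing V']
    [IsLocalRing V'] [Algebra V V'] [IsLocalHom (algebraMap V V')]
    (hfin : @trdegC (ResidueField V) (ResidueField V') _ _
      (RingHom.toAlgebra (ResidueField.map (algebraMap V V'))) < Cardinal.aleph0) :
    ∃ (n : ℕ) (y : Fin n → V'), @trdegC (ResidueField V) (ResidueField V') _ _
        (RingHom.toAlgebra (ResidueField.map (algebraMap V V'))) = n ∧
      ∀ p : MvPolynomial (Fin n) (ResidueField V),
        p.eval₂ (ResidueField.map (algebraMap V V')) (fun i ↦ residue V' (y i)) = 0 → p = 0 := by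
  obtain ⟨n, x, hn, hx⟩ := @exists_algebraicIndependent_fin _ _ _ _
    (RingHom.toAlgebra (ResidueField.map (algebraMap V V'))) hfin
  choose y hy using fun i ↦ IsLocalRing.residue_surjective (x i)
  refine ⟨n, y, hn, fun p hp ↦ ?_⟩
  simp only [hy] at hp
  exact (@algebraicIndependent_iff _ _ _ x _ _
    (RingHom.toAlgebra (ResidueField.map (algebraMap V V')))).1 hx p hp

lemma isUnit_natCast_of_algebra_rat {A : Type*} [CommRing A] [Algebra ℚ A] {n : ℕ} (hn : n ≠ 0) :
    IsUnit (n : A) := by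
  have h1 : IsUnit (n : ℚ) := (Nat.cast_ne_zero.2 hn).isUnit
  simpa using h1.map (algebraMap ℚ A)

/-- If the value group extension is trivial, then every element of the large field has the valuation
of an element of the small field. -/
lemma RingHom.HasTrivialValueGroupExt.exists_valuation_eq {V : Type u} {V' : Type v} [CommRing V]
    [CommRing V'] [IsDomain V'] [Algebra V V'] (hinj : Function.Injective (algebraMap V V'))
    (hvalue : (algebraMap V V').HasTrivialValueGroupExt)
    {K K' : Type*} [Field K] [Field K'] [Algebra V K] [Algebra V' K'] [IsFractionRing V' K']
    [Algebra K K'] [Algebra V K'] [IsScalarTower V K K'] [IsScalarTower V V' K']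
    {O : ValuationSubring K'} (hO : ∀ x, x ∈ O ↔ x ∈ (algebraMap V' K').range) (x : K') :
    ∃ c : K, O.valuation (algebraMap K K' c) = O.valuation x := by
  rcases eq_or_ne x 0 with rfl | hx
  · exact ⟨0, by rw [map_zero]⟩
  obtain ⟨x₁, x₂, hx₂, rfl⟩ := IsFractionRing.div_surjective (A := V') x
  have h2 : x₂ ≠ 0 := nonZeroDivisors.ne_zero hx₂
  have h1 : x₁ ≠ 0 := by
    rintro rfl
    rw [map_zero, zero_div] at hx
    exact hx rfl
  obtain ⟨a, b, -, hb, u, hu⟩ := hvalue x₁ x₂ h1 h2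
  refine ⟨algebraMap V K a / algebraMap V K b, ?_⟩
  have hinj' := IsFractionRing.injective V' K'
  have hb' : algebraMap V' K' (algebraMap V V' b) ≠ 0 := by
    rwa [map_ne_zero_iff _ hinj', map_ne_zero_iff _ hinj]
  have h2' : algebraMap V' K' x₂ ≠ 0 := by rwa [map_ne_zero_iff _ hinj']
  have h3 := congrArg (fun z ↦ O.valuation (algebraMap V' K' z)) hu
  simp only [map_mul, (ValuationSubring.valuation_algebraMap_eq_one_iff hO _).2 u.isUnit,
    mul_one] at h3
  rw [map_div₀, ← IsScalarTower.algebraMap_apply, ← IsScalarTower.algebraMap_apply,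
    IsScalarTower.algebraMap_apply V V' K', IsScalarTower.algebraMap_apply V V' K', map_div₀,
    map_div₀, div_eq_div_iff ((map_ne_zero _).2 hb') ((map_ne_zero _).2 h2'), mul_comm, ← h3]

/-- Let `V ⊆ V'` be an extension of valuation rings containing `ℚ` with residue
field extension `k ⊆ k'` and fraction field extension `K ⊆ K'` of finite type, such that
`trdeg K'/K = trdeg k'/k < ∞` and the value group extension is trivial.  Then `V'` is ind-smooth
over `V`. -/
theorem isIndSmooth_of_trivial_value_group_of_trdeg_eq
    (V : Type u) (V' : Type v) [CommRing V] [IsDomain V] [ValuationRing V]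
    [CommRing V'] [IsDomain V'] [ValuationRing V']
    [Algebra ℚ V] [Algebra ℚ V'] [Algebra V V']
    (hinj : Function.Injective (algebraMap V V'))
    [IsLocalHom (algebraMap V V')]
    (K : Type u) (K' : Type v) [Field K] [Field K']
    [Algebra V K] [IsFractionRing V K] [Algebra V' K'] [IsFractionRing V' K']
    [Algebra K K'] [Algebra V K'] [IsScalarTower V K K'] [IsScalarTower V V' K']
    (hFT : (⊤ : IntermediateField K K').FG)
    (htrdeg : trdegC K K' =
      @trdegC (IsLocalRing.ResidueField V) (IsLocalRing.ResidueField V') _ _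
        (RingHom.toAlgebra (IsLocalRing.ResidueField.map (algebraMap V V'))))
    (hfin : trdegC K K' < Cardinal.aleph0)
    (hvalue : (algebraMap V V').HasTrivialValueGroupExt) :
    (algebraMap V V').IsIndSmooth := by
  obtain ⟨n, y, hn, hy⟩ := exists_lift_transcendenceBasis (V := V) (V' := V') (htrdeg ▸ hfin)
  have hind := (algebraicIndependent_of_residue hinj hy).algebraMap_fractionRing K K'
  have hbasis : IsTranscendenceBasis K fun i ↦ algebraMap V' K' (y i) := by
    refine hind.isTranscendenceBasis_of_lift_trdeg_le_of_finite ?_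
    have h1 : Algebra.trdeg K K' = n := htrdeg.trans hn
    rw [h1]
    simp
  obtain ⟨L, hL⟩ : ∃ L, L = IntermediateField.adjoin K (Set.range fun i ↦ algebraMap V' K' (y i)) :=
    ⟨_, rfl⟩
  have halg : Algebra.IsAlgebraic L K' := hL ▸ hbasis.isAlgebraic_field
  have hfd := IntermediateField.finiteDimensional_of_fg_of_isAlgebraic hFT L
  obtain ⟨O, hO⟩ := ValuationSubring.exists_mem_iff_mem_range_algebraMap (R := V') (F := K')
  have hunit := ValuationSubring.valuation_algebraMap_eq_one_iff hO
  have hnat (m : ℕ) (hm : m ≠ 0) : O.valuation (m : K') = 1 := by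
    rw [← map_natCast (algebraMap V' K'), hunit]
    exact isUnit_natCast_of_algebra_rat hm
  have hchar : CharZero L := by
    refine charZero_of_inj_zero fun m hm ↦ ?_
    by_contra h
    have h1 := hnat m h
    rw [← map_natCast (algebraMap L K'), hm, map_zero, map_zero] at h1
    exact zero_ne_one h1
  obtain ⟨a, haO, hmin, hder, hfrac⟩ := O.exists_primitive_of_valuation_eq (L := L) hnat fun x ↦ by
    obtain ⟨c, hc⟩ := hvalue.exists_valuation_eq (K := K) hinj hO x
    exact ⟨algebraMap K L c, hc⟩
  obtain ⟨a, rfl⟩ := (hO a).1 haO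
  have hlift (z : K') (hz : O.valuation z = 1) : ∃ d, IsUnit d ∧ algebraMap V' K' d = z := by
    obtain ⟨d, rfl⟩ := (hO z).1 ((O.valuation_le_one_iff z).1 hz.le)
    exact ⟨d, (hunit d).1 hz, rfl⟩
  intro E _ _ _ w hw
  classical
  obtain ⟨s, hs⟩ := (inferInstance : Algebra.FiniteType V E).out
  obtain ⟨S, _, _, hS, h, hh, hsh⟩ := exists_smooth_of_fractions hinj hy hL
    (Algebra.IsIntegral.isIntegral (algebraMap V' K' a)) (fun i ↦ (hO _).1 (hmin i))
    (hlift _ hder) (s.image w) fun u _ ↦ by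
      obtain ⟨P, Q, hP, hQ, hQu, hPQ⟩ := hfrac _ ((hO _).2 ⟨u, rfl⟩)
      exact ⟨P, Q, fun i ↦ (hO _).1 (hP i), fun i ↦ (hO _).1 (hQ i), hlift _ hQu, hPQ⟩
  obtain ⟨g, hg⟩ := exists_factor_of_range_le
    ({ w with commutes' := fun r ↦ RingHom.congr_fun hw r } : E →ₐ[V] V') h hh s hs
    fun e he ↦ hsh _ (Finset.mem_image_of_mem w he)
  exact ⟨S, _, _, hS, g, h.toRingHom, RingHom.ext fun e ↦ AlgHom.congr_fun hg e,
    h.comp_algebraMap⟩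
end
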